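/- arXiv:2505.15578 — 4 statements merged into one kernel-verified Lean document; each statement's English description precedes it below -/
import Mathlib

section
/- Let ν > 0. Let (aₙ) be a sequence of smooth functions on [0,1] that is bounded in C¹([0,1]) (there is M with |aₙ(x)| + |aₙ'(x)| ≤ M for all n and all x ∈ [0,1]) and converges uniformly on [0,1] to a smooth function a. Assume that for every n there exist λₙ > 0 and a C² function φₙ with φₙ > 0 on [0,1], φₙ'(0) = φₙ'(1) = 0, −ν φₙ'' − aₙ φₙ = −λₙ φₙ on [0,1], and a point xₙ ∈ [0,1] with aₙ(xₙ) < 0; let uₙ be the corresponding unique positive Neumann solution of −ν uₙ'' + (1/2)(uₙ')² = aₙ uₙ on [0,1]. Assume moreover that a takes both a positive and a negative value on [0,1] and that there exist λ > 0 and a C² function φ with φ > 0 on [0,1], φ'(0) = φ'(1) = 0, and −ν φ'' − a φ = −λ φ on [0,1]. Then (uₙ) converges uniformly on [0,1] to the unique positive Neumann solution u of −ν u'' + (1/2)(u')² = a u on [0,1]. -/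
open Set Filter Topology

/-- `u` is C² on `[0,1]`, with first derivative `u'` and second derivative `u''`. -/
def C2On01 (u u' u'' : ℝ → ℝ) : Prop :=
  (∀ x ∈ Icc (0:ℝ) 1, HasDerivAt u (u' x) x) ∧
  (∀ x ∈ Icc (0:ℝ) 1, HasDerivAt u' (u'' x) x) ∧
  ContinuousOn u'' (Icc (0:ℝ) 1)

/-- `u` is a positive Neumann solution of `-ν u'' + (1/2)(u')² = a u` on `[0,1]`. -/
def PosSol (ν : ℝ) (a u u' u'' : ℝ → ℝ) : Prop :=
  C2On01 u u' u'' ∧ (∀ x ∈ Icc (0:ℝ) 1, 0 < u x) ∧ u' 0 = 0 ∧ u' 1 = 0 ∧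
  ∀ x ∈ Icc (0:ℝ) 1, -ν * u'' x + (1/2) * (u' x)^2 = a x * u x

/-- The spectral hypothesis `λ₁(-ν d²/dx² - a) < 0`, witnessed by a positive Neumann
eigenfunction with eigenvalue `-lam`, `lam > 0`. -/
def NegPrincipalEV (ν : ℝ) (a : ℝ → ℝ) : Prop :=
  ∃ (lam : ℝ) (φ φ' φ'' : ℝ → ℝ), 0 < lam ∧ C2On01 φ φ' φ'' ∧
    (∀ x ∈ Icc (0:ℝ) 1, 0 < φ x) ∧ φ' 0 = 0 ∧ φ' 1 = 0 ∧
    ∀ x ∈ Icc (0:ℝ) 1, -ν * φ'' x - a x * φ x = -lam * φ x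

/-- A function on `[0,1]` whose critical values in the interior and whose boundary values are
at most `C` is at most `C`. -/
lemma le_of_forall_critical_le {f f' : ℝ → ℝ} {C : ℝ}
    (hf : ∀ x ∈ Icc (0:ℝ) 1, HasDerivAt f (f' x) x) (h0 : f 0 ≤ C) (h1 : f 1 ≤ C)
    (hcrit : ∀ x ∈ Icc (0:ℝ) 1, C < f x → f' x ≠ 0) :
    ∀ x ∈ Icc (0:ℝ) 1, f x ≤ C := by
  have hcont : ContinuousOn f (Icc 0 1) := fun x hx => (hf x hx).continuousAt.continuousWithinAt
  obtain ⟨y, hy, hmax⟩ := isCompact_Icc.exists_isMaxOn (nonempty_Icc.2 zero_le_one) hcont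
  intro x hx
  refine (hmax hx).trans ?_
  by_contra! hC
  have hy0 : y ≠ 0 := by rintro rfl; exact absurd h0 hC.not_ge
  have hy1 : y ≠ 1 := by rintro rfl; exact absurd h1 hC.not_ge
  have hmem : Icc (0:ℝ) 1 ∈ 𝓝 y :=
    Icc_mem_nhds (lt_of_le_of_ne hy.1 hy0.symm) (lt_of_le_of_ne hy.2 hy1)
  exact hcrit y hy hC ((hmax.isLocalMax hmem).hasDerivAt_eq_zero (hf y hy))

lemma exists_hasDerivAt_of_continuousOn {E : Type*} [NormedAddCommGroup E] [NormedSpace ℝ E]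
    [CompleteSpace E] {g : ℝ → E} (hg : ContinuousOn g (Icc 0 1)) (c : E) :
    ∃ F : ℝ → E, F 0 = c ∧ ∀ x ∈ Icc (0:ℝ) 1, HasDerivAt F (g x) x := by
  set G : ℝ → E := IccExtend (zero_le_one' ℝ) ((Icc (0:ℝ) 1).domRestrict g)
  have hG : Continuous G := (continuousOn_iff_continuous_domRestrict.1 hg).Icc_extend'
  refine ⟨fun x => c + ∫ t in (0:ℝ)..x, G t, by simp, fun x hx => ?_⟩
  have h := (hG.integral_hasStrictDerivAt 0 x).hasDerivAt.const_add c
  have hGx : G x = g x := by simp [G, IccExtend_of_mem _ _ hx]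
  rwa [hGx] at h

lemma exists_hasDerivAt_of_tendstoUniformlyOn {E : Type*} [NormedAddCommGroup E]
    [NormedSpace ℝ E] [CompleteSpace E] {f g : ℕ → ℝ → E} {f₀ g₀ : ℝ → E}
    (hf : ∀ k, ∀ x ∈ Icc (0:ℝ) 1, HasDerivAt (f k) (g k x) x)
    (hlim : ∀ x ∈ Icc (0:ℝ) 1, Tendsto (fun k => f k x) atTop (𝓝 (f₀ x)))
    (hglim : TendstoUniformlyOn g g₀ atTop (Icc 0 1)) (hg₀ : ContinuousOn g₀ (Icc 0 1)) :
    ∃ F : ℝ → E, EqOn F f₀ (Icc 0 1) ∧ ∀ x ∈ Icc (0:ℝ) 1, HasDerivAt F (g₀ x) x := by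
  obtain ⟨F, hF0, hF⟩ := exists_hasDerivAt_of_continuousOn hg₀ (f₀ 0)
  refine ⟨F, fun x hx => ?_, hF⟩
  have h0 : (0:ℝ) ∈ Icc (0:ℝ) 1 := ⟨le_rfl, zero_le_one⟩
  have hto : Tendsto (fun k => (f k x - F x) - (f k 0 - F 0)) atTop
      (𝓝 ((f₀ x - F x) - (f₀ 0 - F 0))) :=
    ((hlim x hx).sub_const _).sub ((hlim 0 h0).sub_const _)
  have hto' : Tendsto (fun k => (f k x - F x) - (f k 0 - F 0)) atTop (𝓝 0) := by
    rw [Metric.tendsto_atTop]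
    intro ε hε
    obtain ⟨N, hN⟩ := eventually_atTop.1
      (Metric.tendstoUniformlyOn_iff.1 hglim (ε / 2) (by positivity))
    refine ⟨N, fun k hk => ?_⟩
    have h := Convex.norm_image_sub_le_of_norm_hasDerivWithin_le (𝕜 := ℝ)
      (f := fun y => f k y - F y) (f' := fun y => g k y - g₀ y) (s := Icc (0:ℝ) 1) (C := ε / 2)
      (fun y hy => ((hf k y hy).sub (hF y hy)).hasDerivWithinAt)
      (fun y hy => by
        rw [← dist_eq_norm, dist_comm]
        exact (hN k hk y hy).le) (convex_Icc 0 1) h0 hx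
    rw [dist_zero_right]
    have hx1 : ‖x - 0‖ ≤ 1 := by
      rw [sub_zero, Real.norm_eq_abs, abs_of_nonneg hx.1]; exact hx.2
    have : ε / 2 * ‖x - 0‖ ≤ ε / 2 * 1 := by gcongr
    exact h.trans_lt (by linarith)
  have h := tendsto_nhds_unique hto hto'
  rw [hF0, sub_self, sub_zero, sub_eq_zero] at h
  exact h.symm

/-- The first-order vector field for `(log u, u'/u)` when
`-ν u'' + (1/2)(u')² = A u` and `u > 0`. -/
noncomputable def logField (ν : ℝ) (A : ℝ → ℝ) (t : ℝ) (z : ℝ × ℝ) : ℝ × ℝ :=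
  (z.2, ((Real.exp z.1 / 2 - ν) * z.2 ^ 2 - A t) / ν)

/-- `Y` is a Neumann trajectory on `[0,1]` of the field `logField ν A`. -/
def IsLogSol (ν : ℝ) (A : ℝ → ℝ) (Y : ℝ → ℝ × ℝ) : Prop :=
  (∀ x ∈ Icc (0:ℝ) 1, HasDerivAt Y (logField ν A x (Y x)) x) ∧ (Y 0).2 = 0 ∧ (Y 1).2 = 0

lemma IsLogSol.continuousOn {ν : ℝ} {A : ℝ → ℝ} {Y : ℝ → ℝ × ℝ} (h : IsLogSol ν A Y) :
    ContinuousOn Y (Icc 0 1) :=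
  fun x hx => (h.1 x hx).continuousAt.continuousWithinAt

lemma PosSol.isLogSol {ν : ℝ} (hν : 0 < ν) {A u u' u'' : ℝ → ℝ} (h : PosSol ν A u u' u'') :
    IsLogSol ν A (fun x => (Real.log (u x), u' x / u x)) := by
  obtain ⟨⟨hu, hu', -⟩, hpos, h0, h1, heq⟩ := h
  refine ⟨fun x hx => ?_, by simp [h0], by simp [h1]⟩
  have hux := hpos x hx
  refine HasDerivAt.prodMk ((hu x hx).log hux.ne') ?_
  refine ((hu' x hx).div (hu x hx) hux.ne').congr_deriv ?_
  simp only [Real.exp_log hux]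
  field_simp
  linear_combination (-2 * u x) * heq x hx

lemma IsLogSol.posSol {ν : ℝ} (hν : 0 < ν) {A : ℝ → ℝ} (hA : ContinuousOn A (Icc 0 1))
    {Y : ℝ → ℝ × ℝ} (h : IsLogSol ν A Y) :
    PosSol ν A (fun x => Real.exp (Y x).1) (fun x => Real.exp (Y x).1 * (Y x).2)
      (fun x => Real.exp (Y x).1 * (Y x).2 * (Y x).2
        + Real.exp (Y x).1 * (logField ν A x (Y x)).2) := by
  have h1 : ∀ x ∈ Icc (0:ℝ) 1, HasDerivAt (fun x => (Y x).1) (Y x).2 x := fun x hx =>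
    (hasFDerivAt_fst (𝕜 := ℝ) (p := Y x)).comp_hasDerivAt x (h.1 x hx)
  have h2 : ∀ x ∈ Icc (0:ℝ) 1, HasDerivAt (fun x => (Y x).2) (logField ν A x (Y x)).2 x :=
    fun x hx => (hasFDerivAt_snd (𝕜 := ℝ) (p := Y x)).comp_hasDerivAt x (h.1 x hx)
  have hY := h.continuousOn
  refine ⟨⟨fun x hx => (h1 x hx).exp, fun x hx => ((h1 x hx).exp).mul (h2 x hx), ?_⟩,
    fun x _ => Real.exp_pos _, by simp [h.2.1], by simp [h.2.2], fun x _ => ?_⟩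
  · unfold logField
    fun_prop
  · simp only [logField]
    field_simp
    ring

lemma IsLogSol.eq_of_ne_zero {ν : ℝ} (hν : 0 < ν) {a : ℝ → ℝ} {x₀ : ℝ} (hx₀ : x₀ ∈ Ioo (0:ℝ) 1)
    (hax₀ : a x₀ ≠ 0) {Y Z : ℝ → ℝ × ℝ} (hY : IsLogSol ν a Y) (hZ : IsLogSol ν a Z) :
    ∀ x ∈ Icc (0:ℝ) 1, (Y x).1 = (Z x).1 := by
  have hY1 : ∀ x ∈ Icc (0:ℝ) 1, HasDerivAt (fun x => (Y x).1) (Y x).2 x := fun x hx =>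
    (hasFDerivAt_fst (𝕜 := ℝ) (p := Y x)).comp_hasDerivAt x (hY.1 x hx)
  have hY2 : ∀ x ∈ Icc (0:ℝ) 1, HasDerivAt (fun x => (Y x).2) (logField ν a x (Y x)).2 x :=
    fun x hx => (hasFDerivAt_snd (𝕜 := ℝ) (p := Y x)).comp_hasDerivAt x (hY.1 x hx)
  have hZ1 : ∀ x ∈ Icc (0:ℝ) 1, HasDerivAt (fun x => (Z x).1) (Z x).2 x := fun x hx =>
    (hasFDerivAt_fst (𝕜 := ℝ) (p := Z x)).comp_hasDerivAt x (hZ.1 x hx)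
  have hZ2 : ∀ x ∈ Icc (0:ℝ) 1, HasDerivAt (fun x => (Z x).2) (logField ν a x (Z x)).2 x :=
    fun x hx => (hasFDerivAt_snd (𝕜 := ℝ) (p := Z x)).comp_hasDerivAt x (hZ.1 x hx)
  have hYc := hY.continuousOn
  have hZc := hZ.continuousOn
  obtain ⟨H, -, hH⟩ := exists_hasDerivAt_of_continuousOn
    (g := fun x => (Real.exp (Y x).1 / 2 - ν) * ((Y x).2 + (Z x).2) / ν)
    (by fun_prop) 0
  set w : ℝ → ℝ := fun x => ((Y x).1 - (Z x).1) * (((Y x).2 - (Z x).2) * Real.exp (-H x))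
    with hw
  set w' : ℝ → ℝ := fun x => Real.exp (-H x) * (((Y x).2 - (Z x).2) ^ 2 +
    ((Y x).1 - (Z x).1) * (Real.exp (Y x).1 - Real.exp (Z x).1) * (Z x).2 ^ 2 / (2 * ν))
  have hw' : ∀ x ∈ Icc (0:ℝ) 1, HasDerivAt w (w' x) x := by
    intro x hx
    have hd := ((hY1 x hx).sub (hZ1 x hx)).mul
      (((hY2 x hx).sub (hZ2 x hx)).mul (hH x hx).neg.exp)
    refine hd.congr_deriv ?_
    simp only [w', logField, Pi.sub_apply, Pi.mul_apply, Pi.neg_apply]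
    field_simp
    ring
  have hmono : ∀ x, 0 ≤ ((Y x).1 - (Z x).1) * (Real.exp (Y x).1 - Real.exp (Z x).1) := by
    intro x
    rcases le_total (Y x).1 (Z x).1 with hle | hle
    · exact mul_nonneg_of_nonpos_of_nonpos (sub_nonpos.2 hle)
        (sub_nonpos.2 (Real.exp_le_exp.2 hle))
    · exact mul_nonneg (sub_nonneg.2 hle) (sub_nonneg.2 (Real.exp_le_exp.2 hle))
  have hw'0 : ∀ x, 0 ≤ w' x := fun x => by
    have := hmono x
    positivity
  have hwm : MonotoneOn w (Icc 0 1) := by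
    refine monotoneOn_of_deriv_nonneg (convex_Icc 0 1)
      (fun x hx => (hw' x hx).continuousAt.continuousWithinAt)
      (fun x hx => (hw' x (interior_subset hx)).differentiableAt.differentiableWithinAt)
      (fun x hx => ?_)
    rw [(hw' x (interior_subset hx)).deriv]
    exact hw'0 x
  have hwz : ∀ x ∈ Icc (0:ℝ) 1, w x = 0 := by
    intro x hx
    have e0 : w 0 = 0 := by simp [hw, hY.2.1, hZ.2.1]
    have e1 : w 1 = 0 := by simp [hw, hY.2.2, hZ.2.2]
    have l0 := hwm ⟨le_rfl, zero_le_one⟩ hx hx.1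
    have l1 := hwm hx ⟨zero_le_one, le_rfl⟩ hx.2
    linarith
  have hloc : ∀ {f : ℝ → ℝ} {f' c x : ℝ}, x ∈ Ioo (0:ℝ) 1 → (∀ y ∈ Ioo (0:ℝ) 1, f y = c) →
      HasDerivAt f f' x → f' = 0 := by
    intro f f' c x hx hc hd
    refine hd.unique ((hasDerivAt_const x c).congr_of_eventuallyEq ?_)
    filter_upwards [isOpen_Ioo.mem_nhds hx] with y hy using hc y hy
  have hsum : ∀ x ∈ Ioo (0:ℝ) 1, (Y x).2 = (Z x).2 ∧
      ((Y x).1 - (Z x).1) * (Real.exp (Y x).1 - Real.exp (Z x).1) * (Z x).2 ^ 2 = 0 := by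
    intro x hx
    have hz := hloc hx (fun y hy => hwz y (Ioo_subset_Icc_self hy))
      (hw' x (Ioo_subset_Icc_self hx))
    have hz' := (mul_eq_zero.1 hz).resolve_left (Real.exp_ne_zero _)
    have hnn : 0 ≤ ((Y x).1 - (Z x).1) * (Real.exp (Y x).1 - Real.exp (Z x).1) * (Z x).2 ^ 2
        / (2 * ν) := by
      have := hmono x
      positivity
    obtain ⟨hq, hc⟩ := (add_eq_zero_iff_of_nonneg (sq_nonneg _) hnn).1 hz'
    refine ⟨sub_eq_zero.1 (pow_eq_zero_iff two_ne_zero |>.1 hq), ?_⟩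
    exact (div_eq_zero_iff.1 hc).resolve_right (by positivity)
  have hsnd : ∀ x ∈ Icc (0:ℝ) 1, (Y x).2 - (Z x).2 = 0 := by
    intro x hx
    rcases eq_or_lt_of_le hx.1 with rfl | h0
    · rw [hY.2.1, hZ.2.1, sub_self]
    rcases eq_or_lt_of_le hx.2 with rfl | h1
    · rw [hY.2.2, hZ.2.2, sub_self]
    exact sub_eq_zero.2 (hsum x ⟨h0, h1⟩).1
  have hconst : ∀ x ∈ Icc (0:ℝ) 1, (Y x).1 - (Z x).1 = (Y x₀).1 - (Z x₀).1 := by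
    intro x hx
    have hn := Convex.norm_image_sub_le_of_norm_hasDerivWithin_le (𝕜 := ℝ)
      (f := fun y => (Y y).1 - (Z y).1) (f' := fun y => (Y y).2 - (Z y).2) (s := Icc (0:ℝ) 1)
      (C := 0) (fun y hy => ((hY1 y hy).sub (hZ1 y hy)).hasDerivWithinAt)
      (fun y hy => by rw [hsnd y hy, norm_zero]) (convex_Icc 0 1) (Ioo_subset_Icc_self hx₀) hx
    rw [zero_mul] at hn
    exact sub_eq_zero.1 (norm_le_zero_iff.1 hn)
  by_cases hne : (Y x₀).1 - (Z x₀).1 = 0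
  · exact fun x hx => sub_eq_zero.1 ((hconst x hx).trans hne)
  exfalso
  have hZz : ∀ x ∈ Ioo (0:ℝ) 1, (Z x).2 = 0 := by
    intro x hx
    have hd := hconst x (Ioo_subset_Icc_self hx)
    have hd0 : (Y x).1 - (Z x).1 ≠ 0 := by rwa [hd]
    have he0 : Real.exp (Y x).1 - Real.exp (Z x).1 ≠ 0 :=
      sub_ne_zero.2 fun he => hd0 (sub_eq_zero.2 (Real.exp_injective he))
    exact pow_eq_zero_iff two_ne_zero |>.1
      ((mul_eq_zero.1 (hsum x hx).2).resolve_left (mul_ne_zero hd0 he0))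
  have hz := hloc hx₀ hZz (hZ2 x₀ (Ioo_subset_Icc_self hx₀))
  simp only [logField, hZz x₀ hx₀] at hz
  have : a x₀ / ν = 0 := by linear_combination -hz
  exact hax₀ ((div_eq_zero_iff.1 this).resolve_right hν.ne')

section Bounds

variable {ν M : ℝ} {A u u' u'' : ℝ → ℝ}

lemma PosSol.sq_deriv_le (hν : 0 < ν) (hM : 0 < M) (hA : ∀ x ∈ Icc (0:ℝ) 1, |A x| ≤ M)
    (h : PosSol ν A u u' u'') : ∀ x ∈ Icc (0:ℝ) 1, u' x ^ 2 ≤ 2 * M * (u x + ν) := by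
  obtain ⟨⟨hu, hu', -⟩, hpos, h0, h1, heq⟩ := h
  have hb : ∀ y ∈ Icc (0:ℝ) 1, u' y = 0 → u' y ^ 2 - 2 * M * u y ≤ 2 * M * ν := by
    intro y hy hy0
    have := hpos y hy
    rw [hy0]
    nlinarith [mul_pos hM this, mul_pos hM hν]
  have key := le_of_forall_critical_le (f := fun x => u' x ^ 2 - 2 * M * u x) (C := 2 * M * ν)
    (fun x hx => ((hu' x hx).pow 2).sub ((hu x hx).const_mul (2 * M)))
    (hb 0 (by simp) h0) (hb 1 (by simp) h1) (fun x hx hlt => ?_)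
  · intro x hx
    have := key x hx
    linarith
  · have hux := hpos x hx
    have hA' := (abs_le.1 (hA x hx)).2
    have hne : u' x ≠ 0 := by
      intro hx0
      exact absurd (hb x hx hx0) hlt.not_ge
    have hAu : A x * u x ≤ M * u x := by gcongr
    have hlt' : 0 < ν * (u'' x - M) := by nlinarith [heq x hx]
    have hne' : u'' x - M ≠ 0 := (pos_of_mul_pos_right hlt' hν.le).ne'
    have : 2 * u' x * (u'' x - M) ≠ 0 := by positivity
    convert this using 1
    simp
    ring

lemma PosSol.sq_deriv_le_sq (hν : 0 < ν) (hM : 0 < M) (hA : ∀ x ∈ Icc (0:ℝ) 1, |A x| ≤ M)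
    (h : PosSol ν A u u' u'') : ∀ x ∈ Icc (0:ℝ) 1, (u' x / u x) ^ 2 ≤ 4 * M / ν := by
  have hgrad := h.sq_deriv_le hν hM hA
  obtain ⟨⟨hu, hu', -⟩, hpos, h0, h1, heq⟩ := h
  refine le_of_forall_critical_le (f := fun x => (u' x / u x) ^ 2)
    (fun x hx => ((hu' x hx).div (hu x hx) (hpos x hx).ne').pow 2)
    (by simp only [h0]; simp; positivity) (by simp only [h1]; simp; positivity)
    (fun x hx hlt => ?_)
  have hux := hpos x hx
  have hA' := (abs_le.1 (hA x hx)).1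
  simp only [div_pow] at hlt
  rw [div_lt_div_iff₀ hν (by positivity)] at hlt
  have hsmall : u x < ν := by
    by_contra! hle
    have := hgrad x hx
    have h2 : u' x ^ 2 * ν ≤ 2 * M * (u x + u x) * u x := by gcongr; exact this.trans (by gcongr)
    nlinarith
  have hne : u' x ≠ 0 := by
    intro hx0
    rw [hx0] at hlt
    have : 0 < 4 * M * u x ^ 2 := by positivity
    linarith
  have hAu : -M * u x ^ 2 ≤ A x * u x ^ 2 := by gcongr
  have h3 : u' x ^ 2 * u x ≤ u' x ^ 2 * ν := by gcongr
  have hlt' : ν * (u'' x * u x - u' x * u' x) < 0 := by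
    have : ν * (u'' x * u x - u' x * u' x)
        = u' x ^ 2 * u x / 2 - A x * u x ^ 2 - u' x ^ 2 * ν := by
      linear_combination (-u x) * heq x hx
    rw [this]
    nlinarith [mul_pos hM (pow_pos hux 2)]
  have hne' : u'' x * u x - u' x * u' x ≠ 0 := (neg_of_mul_neg_right hlt' hν.le).ne
  simp only [Nat.cast_ofNat, Pi.div_apply, ne_eq]
  positivity

lemma PosSol.exists_le_apply (hν : 0 < ν) (hM : 0 < M) (hA : ∀ x ∈ Icc (0:ℝ) 1, |A x| ≤ M)
    (h : PosSol ν A u u' u'') {a φ φ' φ'' : ℝ → ℝ} {lam : ℝ}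
    (hφ : C2On01 φ φ' φ'') (hφpos : ∀ x ∈ Icc (0:ℝ) 1, 0 < φ x) (hφ0 : φ' 0 = 0)
    (hφ1 : φ' 1 = 0) (hφeq : ∀ x ∈ Icc (0:ℝ) 1, -ν * φ'' x - a x * φ x = -lam * φ x)
    (hAa : ∀ x ∈ Icc (0:ℝ) 1, |A x - a x| ≤ lam / 2) :
    ∃ x ∈ Icc (0:ℝ) 1, lam * ν / (4 * M) ≤ u x := by
  by_contra! hlt
  have hgrad := h.sq_deriv_le_sq hν hM hA
  obtain ⟨⟨hu, hu', -⟩, hpos, h0, h1, heq⟩ := h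
  obtain ⟨hd, hd', -⟩ := hφ
  have hW : ∀ x ∈ Icc (0:ℝ) 1, HasDerivAt (fun x => u x * φ' x - u' x * φ x)
      (u x * φ'' x - u'' x * φ x) x := fun x hx =>
    (((hu x hx).mul (hd' x hx)).sub ((hu' x hx).mul (hd x hx))).congr_deriv (by ring)
  obtain ⟨x, hx, hx0⟩ := exists_hasDerivAt_eq_zero (zero_lt_one' ℝ)
    (fun x hx => (hW x hx).continuousAt.continuousWithinAt) (by simp [h0, h1, hφ0, hφ1])
    (fun x hx => hW x (Ioo_subset_Icc_self hx))
  have hxI := Ioo_subset_Icc_self hx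
  have hux := hpos x hxI
  have hg := hgrad x hxI
  have hs := hlt x hxI
  rw [div_pow, div_le_div_iff₀ (by positivity) hν] at hg
  rw [lt_div_iff₀ (by positivity)] at hs
  have hsq : u' x ^ 2 < lam * u x := by
    have : u x * (4 * M) * u x < lam * ν * u x := by gcongr
    exact lt_of_mul_lt_mul_right (by linarith) hν.le
  have hA' : -(lam / 2) * u x ≤ (A x - a x) * u x := by
    gcongr
    exact (abs_le.1 (hAa x hxI)).1
  have hfac : φ x * ((lam + (A x - a x)) * u x - u' x ^ 2 / 2) = 0 := by
    linear_combination ν * hx0 + u x * hφeq x hxI - φ x * heq x hxI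
  have := (mul_eq_zero.1 hfac).resolve_left (hφpos x hxI).ne'
  linarith

lemma PosSol.exists_apply_le (hν : 0 < ν) (hM : 0 < M) (hA : ∀ x ∈ Icc (0:ℝ) 1, |A x| ≤ M)
    (h : PosSol ν A u u' u'') {x₁ x₂ δ η : ℝ} (hx₁ : 0 ≤ x₁) (hx₂ : x₂ ≤ 1) (hlt : x₁ < x₂)
    (hη : 0 < η) (hneg : ∀ x ∈ Icc x₁ x₂, A x ≤ -δ) (hδη : 2 * η < δ / ν * (x₂ - x₁)) :
    ∃ x ∈ Icc (0:ℝ) 1, u x ≤ max (2 * ν) (4 * M / η ^ 2) := by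
  by_contra! hbig
  have hgrad := h.sq_deriv_le hν hM hA
  obtain ⟨⟨hu, hu', -⟩, hpos, -, -, heq⟩ := h
  have hsub : Icc x₁ x₂ ⊆ Icc 0 1 := Icc_subset_Icc hx₁ hx₂
  have hd : ∀ x ∈ Icc (0:ℝ) 1, HasDerivAt (fun x => u' x / u x)
      ((u'' x * u x - u' x * u' x) / u x ^ 2) x := fun x hx =>
    (hu' x hx).div (hu x hx) (hpos x hx).ne'
  have hp : ∀ x ∈ Icc (0:ℝ) 1, |u' x / u x| ≤ η := by
    intro x hx
    have hux := hpos x hx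
    obtain ⟨h2, h3⟩ := max_lt_iff.1 (hbig x hx)
    rw [div_lt_iff₀ (by positivity)] at h3
    refine abs_le_of_sq_le_sq ?_ hη.le
    rw [div_pow, div_le_iff₀ (by positivity)]
    have : 4 * M * u x ≤ u x * η ^ 2 * u x := by gcongr
    nlinarith [hgrad x hx]
  obtain ⟨c, hc, hslope⟩ := exists_hasDerivAt_eq_slope (fun x => u' x / u x)
    (fun x => (u'' x * u x - u' x * u' x) / u x ^ 2) hlt
    (fun x hx => (hd x (hsub hx)).continuousAt.continuousWithinAt)
    (fun x hx => hd x (hsub (Ioo_subset_Icc_self hx)))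
  have hc' := Ioo_subset_Icc_self hc
  have huc := hpos c (hsub hc')
  have h2 := (max_lt_iff.1 (hbig c (hsub hc'))).1
  have hge : δ / ν ≤ (u'' c * u c - u' c * u' c) / u c ^ 2 := by
    rw [div_le_div_iff₀ hν (by positivity)]
    have hAc : A c * u c ^ 2 ≤ -δ * u c ^ 2 := by gcongr; exact hneg c hc'
    have h4 : u' c ^ 2 * (2 * ν) ≤ u' c ^ 2 * u c := by gcongr
    have : (u'' c * u c - u' c * u' c) * ν
        = u' c ^ 2 * u c / 2 - A c * u c ^ 2 - u' c ^ 2 * ν := by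
      linear_combination (-u c) * heq c (hsub hc')
    rw [this]
    linarith
  have hl : 0 < x₂ - x₁ := sub_pos.2 hlt
  rw [hslope, le_div_iff₀ hl] at hge
  have e1 := abs_le.1 (hp x₁ (hsub ⟨le_rfl, hlt.le⟩))
  have e2 := abs_le.1 (hp x₂ (hsub ⟨hlt.le, le_rfl⟩))
  linarith [e1.1, e2.2]

lemma PosSol.norm_log_le (hν : 0 < ν) (hM : 0 < M) (hA : ∀ x ∈ Icc (0:ℝ) 1, |A x| ≤ M)
    (h : PosSol ν A u u' u'') {m B : ℝ} (hm : 0 < m) (hlow : ∃ x ∈ Icc (0:ℝ) 1, m ≤ u x)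
    (hup : ∃ x ∈ Icc (0:ℝ) 1, u x ≤ B) :
    ∀ x ∈ Icc (0:ℝ) 1, ‖(Real.log (u x), u' x / u x)‖
      ≤ |Real.log m| + |Real.log B| + √(4 * M / ν) := by
  have hlip : ∀ x ∈ Icc (0:ℝ) 1, |u' x / u x| ≤ √(4 * M / ν) := fun x hx =>
    Real.abs_le_sqrt (h.sq_deriv_le_sq hν hM hA x hx)
  obtain ⟨⟨hu, -, -⟩, hpos, -⟩ := h
  have hosc : ∀ x ∈ Icc (0:ℝ) 1, ∀ y ∈ Icc (0:ℝ) 1,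
      Real.log (u y) - Real.log (u x) ≤ √(4 * M / ν) := by
    intro x hx y hy
    have hn := Convex.norm_image_sub_le_of_norm_hasDerivWithin_le (𝕜 := ℝ)
      (f := fun y => Real.log (u y)) (s := Icc (0:ℝ) 1)
      (fun y hy => ((hu y hy).log (hpos y hy).ne').hasDerivWithinAt)
      hlip (convex_Icc 0 1) hx hy
    have hxy : ‖y - x‖ ≤ 1 := by
      rw [Real.norm_eq_abs, abs_le]
      constructor <;> linarith [hx.1, hx.2, hy.1, hy.2]
    exact (le_abs_self _).trans (hn.trans (mul_le_of_le_one_right (Real.sqrt_nonneg _) hxy))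
  obtain ⟨x₁, hx₁, h₁⟩ := hlow
  obtain ⟨x₂, hx₂, h₂⟩ := hup
  have hl₁ := Real.log_le_log hm h₁
  have hl₂ := Real.log_le_log (hpos x₂ hx₂) h₂
  intro x hx
  rw [Prod.norm_mk]
  refine max_le ?_ ((hlip x hx).trans (le_add_of_nonneg_left (by positivity)))
  rw [Real.norm_eq_abs, abs_le]
  have e₁ := hosc x hx x₁ hx₁
  have e₂ := hosc x₂ hx₂ x hx
  constructor <;> linarith [neg_abs_le (Real.log m), le_abs_self (Real.log B),
    abs_nonneg (Real.log m), abs_nonneg (Real.log B)]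

end Bounds

lemma exists_lipschitzOnWith_logField (ν R : ℝ) :
    ∃ K : NNReal, 1 ≤ K ∧
      ∀ A t, LipschitzOnWith K (logField ν A t) (Metric.closedBall 0 R) := by
  have hsmooth : ContDiff ℝ 1 (logField ν 0 0) := by
    unfold logField
    fun_prop
  obtain ⟨K, hK⟩ := hsmooth.contDiffOn.exists_lipschitzOnWith one_ne_zero
    (convex_closedBall (0 : ℝ × ℝ) R) (isCompact_closedBall _ _)
  refine ⟨max K 1, le_max_right _ _, fun A t => ?_⟩
  refine LipschitzOnWith.of_dist_le_mul fun x hx y hy => ?_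
  have h := (hK.weaken (le_max_left K 1)).dist_le_mul x hx y hy
  convert h using 1
  rw [dist_eq_norm, dist_eq_norm]
  congr 1
  ext
  · simp [logField]
  · simp only [logField, Prod.snd_sub, Pi.zero_apply]
    ring

lemma dist_logField_logField {ν : ℝ} (hν : 0 < ν) (A B : ℝ → ℝ) (t : ℝ) (z : ℝ × ℝ) :
    dist (logField ν A t z) (logField ν B t z) = |A t - B t| / ν := by
  have : logField ν A t z - logField ν B t z = (0, -(A t - B t) / ν) := by
    ext
    · simp [logField]
    · simp only [logField, Prod.snd_sub]
      ring
  rw [dist_eq_norm, this, Prod.norm_mk, norm_zero, Real.norm_eq_abs, abs_div, abs_neg,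
    abs_of_pos hν]
  exact max_eq_right (by positivity)

/-- Continuous dependence of bounded trajectories on the initial value and the coefficient. -/
lemma IsLogSol.exists_dist_le {ν : ℝ} (hν : 0 < ν) (R : ℝ) :
    ∃ C : ℝ, 0 < C ∧ ∀ (A B : ℝ → ℝ) (Y Z : ℝ → ℝ × ℝ) (ε : ℝ), 0 ≤ ε →
      IsLogSol ν A Y → IsLogSol ν B Z →
      (∀ x ∈ Icc (0:ℝ) 1, ‖Y x‖ ≤ R) → (∀ x ∈ Icc (0:ℝ) 1, ‖Z x‖ ≤ R) →
      (∀ x ∈ Icc (0:ℝ) 1, |A x - B x| ≤ ε) →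
      ∀ x ∈ Icc (0:ℝ) 1, dist (Y x) (Z x) ≤ C * (|(Y 0).1 - (Z 0).1| + ε) := by
  obtain ⟨K, hK1, hK⟩ := exists_lipschitzOnWith_logField ν R
  refine ⟨Real.exp K * (1 + 1 / ν), by positivity, ?_⟩
  intro A B Y Z ε hε hY hZ hYR hZR hAB x hx
  have h0 : dist (Y 0) (Z 0) ≤ |(Y 0).1 - (Z 0).1| := by
    rw [Prod.dist_eq, hY.2.1, hZ.2.1, dist_self, Real.dist_eq]
    exact max_le le_rfl (abs_nonneg _)
  have h := dist_le_of_approx_trajectories_ODE_of_mem (v := logField ν A)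
    (s := fun _ => Metric.closedBall 0 R) (εf := 0) (εg := ε / ν)
    (fun t _ => hK A t) hY.continuousOn
    (fun t ht => (hY.1 t (Ico_subset_Icc_self ht)).hasDerivWithinAt)
    (fun t _ => (dist_self _).le)
    (fun t ht => mem_closedBall_zero_iff.2 (hYR t (Ico_subset_Icc_self ht))) hZ.continuousOn
    (fun t ht => (hZ.1 t (Ico_subset_Icc_self ht)).hasDerivWithinAt)
    (fun t ht => by
      rw [dist_logField_logField hν, abs_sub_comm]
      have := hAB t (Ico_subset_Icc_self ht)
      gcongr)
    (fun t ht => mem_closedBall_zero_iff.2 (hZR t (Ico_subset_Icc_self ht))) h0 x hx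
  have hKr : (1:ℝ) ≤ K := by exact_mod_cast hK1
  have hK0 : (0:ℝ) < K := by linarith
  rw [gronwallBound_of_K_ne_0 hK0.ne'] at h
  refine h.trans ?_
  have hexp : Real.exp (K * (x - 0)) ≤ Real.exp K := by
    rw [Real.exp_le_exp]
    nlinarith [hx.2]
  have hexp1 : 0 ≤ Real.exp (K * (x - 0)) - 1 := by
    rw [sub_nonneg, Real.one_le_exp_iff]
    have := hx.1
    rw [sub_zero]
    positivity
  have hdiv : (0 + ε / ν) / K ≤ ε / ν := by
    rw [zero_add]
    exact div_le_self (by positivity) hKr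
  calc |(Y 0).1 - (Z 0).1| * Real.exp (K * (x - 0))
        + (0 + ε / ν) / K * (Real.exp (K * (x - 0)) - 1)
      ≤ |(Y 0).1 - (Z 0).1| * Real.exp K + ε / ν * Real.exp K := by
        gcongr
        linarith
    _ ≤ Real.exp K * (1 + 1 / ν) * (|(Y 0).1 - (Z 0).1| + ε) := by
        have h1 : 0 ≤ Real.exp K * (1 / ν) * |(Y 0).1 - (Z 0).1| := by positivity
        have h2 : 0 ≤ Real.exp K * ε := by positivity
        have h3 : ε / ν * Real.exp K = Real.exp K * (1 / ν) * ε := by ring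
        linarith

lemma exists_tendstoUniformlyOn_isLogSol {ν : ℝ} (hν : 0 < ν) {R c : ℝ} {B : ℕ → ℝ → ℝ}
    {a : ℝ → ℝ} (hB : TendstoUniformlyOn B a atTop (Icc 0 1)) (ha : ContinuousOn a (Icc 0 1))
    {Y : ℕ → ℝ → ℝ × ℝ} (hY : ∀ k, IsLogSol ν (B k) (Y k))
    (hR : ∀ k, ∀ x ∈ Icc (0:ℝ) 1, ‖Y k x‖ ≤ R)
    (hc : Tendsto (fun k => (Y k 0).1) atTop (𝓝 c)) :
    ∃ Z, IsLogSol ν a Z ∧ TendstoUniformlyOn Y Z atTop (Icc 0 1) := by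
  obtain ⟨C, hC, hstab⟩ := IsLogSol.exists_dist_le hν R
  have hcauchy : UniformCauchySeqOn Y atTop (Icc 0 1) := by
    rw [Metric.uniformCauchySeqOn_iff]
    intro ε hε
    have hε' : 0 < ε / (4 * C) := by positivity
    obtain ⟨N₁, hN₁⟩ := Metric.uniformCauchySeqOn_iff.1 hB.uniformCauchySeqOn _ hε'
    obtain ⟨N₂, hN₂⟩ := Metric.cauchySeq_iff.1 hc.cauchySeq _ hε'
    refine ⟨max N₁ N₂, fun m hm n hn x hx => ?_⟩
    have h0 := hN₂ m (le_of_max_le_right hm) n (le_of_max_le_right hn)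
    have h := hstab (B m) (B n) (Y m) (Y n) (ε / (4 * C)) hε'.le (hY m) (hY n) (hR m) (hR n)
      (fun y hy => (hN₁ m (le_of_max_le_left hm) n (le_of_max_le_left hn) y hy).le) x hx
    rw [Real.dist_eq] at h0
    calc dist (Y m x) (Y n x) ≤ C * (|(Y m 0).1 - (Y n 0).1| + ε / (4 * C)) := h
      _ ≤ C * (ε / (4 * C) + ε / (4 * C)) := by gcongr
      _ = ε / 2 := by field_simp; norm_num
      _ < ε := by linarith
  have hpt : ∀ x, ∃ z, x ∈ Icc (0:ℝ) 1 → Tendsto (fun k => Y k x) atTop (𝓝 z) := by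
    intro x
    by_cases hx : x ∈ Icc (0:ℝ) 1
    · obtain ⟨z, hz⟩ := cauchySeq_tendsto_of_complete (hcauchy.cauchySeq hx)
      exact ⟨z, fun _ => hz⟩
    · exact ⟨0, fun h => absurd h hx⟩
  choose Z₀ hZ₀ using hpt
  have hlim : TendstoUniformlyOn Y Z₀ atTop (Icc 0 1) :=
    hcauchy.tendstoUniformlyOn_of_tendsto hZ₀
  have hZ₀c : ContinuousOn Z₀ (Icc 0 1) :=
    hlim.continuousOn (Frequently.of_forall fun k => (hY k).continuousOn)
  have hZ₀R : ∀ x ∈ Icc (0:ℝ) 1, ‖Z₀ x‖ ≤ R := fun x hx =>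
    le_of_tendsto (hZ₀ x hx).norm (Eventually.of_forall fun k => hR k x hx)
  obtain ⟨K, hK1, hK⟩ := exists_lipschitzOnWith_logField ν R
  have hK0 : (0:ℝ) < K := by exact_mod_cast lt_of_lt_of_le zero_lt_one hK1
  have hfield : TendstoUniformlyOn (fun k x => logField ν (B k) x (Y k x))
      (fun x => logField ν a x (Z₀ x)) atTop (Icc 0 1) := by
    rw [Metric.tendstoUniformlyOn_iff]
    intro ε hε
    filter_upwards [Metric.tendstoUniformlyOn_iff.1 hB (ν * (ε / 2)) (by positivity),
      Metric.tendstoUniformlyOn_iff.1 hlim (ε / 2 / K) (by positivity)] with k h1 h2 x hx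
    have e1 := h1 x hx
    have e2 := (hK a x).dist_le_mul (Z₀ x) (mem_closedBall_zero_iff.2 (hZ₀R x hx)) (Y k x)
      (mem_closedBall_zero_iff.2 (hR k x hx))
    have e3 := h2 x hx
    rw [lt_div_iff₀' hK0] at e3
    rw [Real.dist_eq, ← div_lt_iff₀' hν] at e1
    have e4 := dist_logField_logField hν a (B k) x (Y k x)
    linarith [dist_triangle (logField ν a x (Z₀ x)) (logField ν a x (Y k x))
      (logField ν (B k) x (Y k x))]
  obtain ⟨Z, hZeq, hZ⟩ := exists_hasDerivAt_of_tendstoUniformlyOn (fun k => (hY k).1) hZ₀ hfield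
    (by unfold logField; fun_prop)
  refine ⟨Z, ⟨fun x hx => ?_, ?_, ?_⟩, hlim.congr_right hZeq.symm⟩
  · rw [hZeq hx]
    exact hZ x hx
  · have h0 : (0:ℝ) ∈ Icc (0:ℝ) 1 := by simp
    rw [hZeq h0]
    refine tendsto_nhds_unique ((continuous_snd.tendsto _).comp (hZ₀ 0 h0)) ?_
    exact tendsto_const_nhds.congr fun k => (hY k).2.1.symm
  · have h1 : (1:ℝ) ∈ Icc (0:ℝ) 1 := by simp
    rw [hZeq h1]
    refine tendsto_nhds_unique ((continuous_snd.tendsto _).comp (hZ₀ 1 h1)) ?_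
    exact tendsto_const_nhds.congr fun k => (hY k).2.2.symm

lemma exists_Icc_le_neg {a : ℝ → ℝ} (ha : ContinuousOn a (Icc 0 1))
    (hneg : ∃ x ∈ Icc (0:ℝ) 1, a x < 0) :
    ∃ x₁ x₂ δ : ℝ, 0 ≤ x₁ ∧ x₂ ≤ 1 ∧ x₁ < x₂ ∧ 0 < δ ∧ ∀ x ∈ Icc x₁ x₂, a x ≤ -δ := by
  obtain ⟨x₀, hx₀, h₀⟩ := hneg
  obtain ⟨η, hη, hball⟩ := Metric.continuousWithinAt_iff.1 (ha x₀ hx₀) (-a x₀ / 2) (by linarith)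
  have key : ∀ x ∈ Icc (0:ℝ) 1, |x - x₀| < η → a x ≤ -(-a x₀ / 2) := by
    intro x hx hxη
    have := hball hx hxη
    rw [Real.dist_eq, abs_lt] at this
    linarith [this.2]
  have hr : 0 < min (η / 2) (1 / 2) := by positivity
  have hr₁ : min (η / 2) (1 / 2) ≤ η / 2 := min_le_left _ _
  have hr₂ : min (η / 2) (1 / 2) ≤ 1 / 2 := min_le_right _ _
  rcases le_total x₀ (1 / 2) with hle | hle
  · refine ⟨x₀, x₀ + min (η / 2) (1 / 2), -a x₀ / 2, hx₀.1, by linarith, by linarith,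
      by linarith, fun x hx => key x ⟨by linarith [hx.1, hx₀.1], by linarith [hx.2]⟩ ?_⟩
    rw [abs_lt]
    constructor <;> linarith [hx.1, hx.2]
  · refine ⟨x₀ - min (η / 2) (1 / 2), x₀, -a x₀ / 2, by linarith, hx₀.2, by linarith,
      by linarith, fun x hx => key x ⟨by linarith [hx.1], by linarith [hx.2, hx₀.2]⟩ ?_⟩
    rw [abs_lt]
    constructor <;> linarith [hx.1, hx.2]

lemma exists_eventually_norm_log_le {ν M : ℝ} (hν : 0 < ν) (hM : 0 < M) {A : ℕ → ℝ → ℝ}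
    {a : ℝ → ℝ} (hA : ∀ n, ∀ x ∈ Icc (0:ℝ) 1, |A n x| ≤ M)
    (hconv : TendstoUniformlyOn A a atTop (Icc 0 1)) (ha : ContinuousOn a (Icc 0 1))
    (hneg : ∃ x ∈ Icc (0:ℝ) 1, a x < 0) (hev : NegPrincipalEV ν a) {U U' U'' : ℕ → ℝ → ℝ}
    (hU : ∀ n, PosSol ν (A n) (U n) (U' n) (U'' n)) :
    ∃ R, ∀ᶠ n in atTop, ∀ x ∈ Icc (0:ℝ) 1, ‖(Real.log (U n x), U' n x / U n x)‖ ≤ R := by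
  obtain ⟨lam, φ, φ', φ'', hlam, hφ, hφpos, hφ0, hφ1, hφeq⟩ := hev
  obtain ⟨x₁, x₂, δ, hx₁, hx₂, hlt, hδ, hle⟩ := exists_Icc_le_neg ha hneg
  have hl : 0 < x₂ - x₁ := sub_pos.2 hlt
  set η := δ / 2 / ν * (x₂ - x₁) / 4 with hη
  have hη0 : 0 < η := by positivity
  refine ⟨|Real.log (lam * ν / (4 * M))| + |Real.log (max (2 * ν) (4 * M / η ^ 2))|
    + √(4 * M / ν), ?_⟩
  filter_upwards [Metric.tendstoUniformlyOn_iff.1 hconv (min (lam / 2) (δ / 2)) (by positivity)]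
    with n hn
  have hn₁ : ∀ x ∈ Icc (0:ℝ) 1, |A n x - a x| ≤ lam / 2 := fun x hx => by
    rw [abs_sub_comm]
    exact (hn x hx).le.trans (min_le_left _ _)
  have hn₂ : ∀ x ∈ Icc x₁ x₂, A n x ≤ -(δ / 2) := fun x hx => by
    have h := (hn x ⟨hx₁.trans hx.1, hx.2.trans hx₂⟩).le.trans (min_le_right _ _)
    rw [Real.dist_eq, abs_le] at h
    linarith [h.1, hle x hx]
  exact (hU n).norm_log_le hν hM (hA n) (by positivity)
    ((hU n).exists_le_apply hν hM (hA n) hφ hφpos hφ0 hφ1 hφeq hn₁)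
    ((hU n).exists_apply_le hν hM (hA n) hx₁ hx₂ hlt hη0 hn₂ (by linarith))

lemma exists_subseq_tendstoUniformlyOn_isLogSol {ν R : ℝ} (hν : 0 < ν) {A : ℕ → ℝ → ℝ}
    {a : ℝ → ℝ} (hA : TendstoUniformlyOn A a atTop (Icc 0 1)) (ha : ContinuousOn a (Icc 0 1))
    {Y : ℕ → ℝ → ℝ × ℝ} (hY : ∀ n, IsLogSol ν (A n) (Y n))
    (hR : ∀ᶠ n in atTop, ∀ x ∈ Icc (0:ℝ) 1, ‖Y n x‖ ≤ R) {ns : ℕ → ℕ}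
    (hns : Tendsto ns atTop atTop) :
    ∃ (ms : ℕ → ℕ) (Z : ℝ → ℝ × ℝ), IsLogSol ν a Z ∧
      TendstoUniformlyOn (fun k x => Real.exp (Y (ns (ms k)) x).1) (fun x => Real.exp (Z x).1)
        atTop (Icc 0 1) := by
  obtain ⟨k₀, hk₀⟩ := eventually_atTop.1 (hns.eventually hR)
  have hmem : ∀ k, (Y (ns (k + k₀)) 0).1 ∈ Icc (-R) R := fun k =>
    abs_le.1 ((norm_fst_le _).trans (hk₀ _ (Nat.le_add_left _ _) 0 (by simp)))
  obtain ⟨c, -, θ, hθ, hc⟩ := isCompact_Icc.tendsto_subseq hmem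
  have hto : Tendsto (fun k => ns (θ k + k₀)) atTop atTop :=
    hns.comp ((tendsto_add_atTop_nat k₀).comp hθ.tendsto_atTop)
  have hR' : ∀ k, ∀ x ∈ Icc (0:ℝ) 1, ‖Y (ns (θ k + k₀)) x‖ ≤ R := fun k =>
    hk₀ _ (Nat.le_add_left _ _)
  obtain ⟨Z, hZ, hlim⟩ := exists_tendstoUniformlyOn_isLogSol hν
    (B := fun k => A (ns (θ k + k₀))) (fun s hs => hto.eventually (hA s hs)) ha
    (fun k => hY _) hR' hc
  have hunif : UniformContinuousOn (fun z : ℝ × ℝ => Real.exp z.1) (Metric.closedBall 0 R) :=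
    (isCompact_closedBall _ _).uniformContinuousOn_of_continuous (by fun_prop)
  refine ⟨fun k => θ k + k₀, Z, hZ, hunif.comp_tendstoUniformlyOn_eventually
    (Eventually.of_forall fun k x hx => mem_closedBall_zero_iff.2 (hR' k x hx))
    (fun x hx => mem_closedBall_zero_iff.2 ?_) hlim⟩
  exact le_of_tendsto (hlim.tendsto_at hx).norm (Eventually.of_forall fun k => hR' k x hx)

/-- Proposition 3.5 (second alternative): stability of the positive solution with respect to the
coefficient `a`: if the smooth coefficients `aₙ` are bounded in `C¹([0,1])`, converge uniformly to
`a`, all satisfy the assumptions of Theorem 3.1, and so does `a`, then the corresponding positive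
Neumann solutions `uₙ` converge uniformly on `[0,1]` to the unique positive Neumann solution for
the limit coefficient `a`. -/
theorem stmt_15 (ν : ℝ) (hν : 0 < ν)
    (A A' : ℕ → ℝ → ℝ) (a : ℝ → ℝ)
    (hA_smooth : ∀ n, ContDiffOn ℝ (⊤ : ℕ∞) (A n) (Icc (0:ℝ) 1))
    (hA_deriv : ∀ n, ∀ x ∈ Icc (0:ℝ) 1, HasDerivAt (A n) (A' n x) x)
    (M : ℝ) (hM : ∀ n, ∀ x ∈ Icc (0:ℝ) 1, |A n x| + |A' n x| ≤ M)
    (ha_smooth : ContDiffOn ℝ (⊤ : ℕ∞) a (Icc (0:ℝ) 1))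
    (hA_conv : TendstoUniformlyOn A a atTop (Icc (0:ℝ) 1))
    (hA_ev : ∀ n, NegPrincipalEV ν (A n))
    (hA_neg : ∀ n, ∃ x ∈ Icc (0:ℝ) 1, A n x < 0)
    (U U' U'' : ℕ → ℝ → ℝ)
    (hU : ∀ n, PosSol ν (A n) (U n) (U' n) (U'' n))
    (ha_pos : ∃ x ∈ Icc (0:ℝ) 1, 0 < a x)
    (ha_neg : ∃ x ∈ Icc (0:ℝ) 1, a x < 0)
    (ha_ev : NegPrincipalEV ν a) :
    ∃ u u' u'' : ℝ → ℝ, PosSol ν a u u' u'' ∧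
      (∀ v v' v'' : ℝ → ℝ, PosSol ν a v v' v'' → ∀ x ∈ Icc (0:ℝ) 1, v x = u x) ∧
      TendstoUniformlyOn U u atTop (Icc (0:ℝ) 1) := by
  have haC : ContinuousOn a (Icc 0 1) := ha_smooth.continuousOn
  obtain ⟨R, hR⟩ := exists_eventually_norm_log_le hν (M := |M| + 1) (by positivity)
    (fun n x hx => by linarith [hM n x hx, abs_nonneg (A' n x), le_abs_self M])
    hA_conv haC ha_neg ha_ev hU
  obtain ⟨x₁, x₂, δ, hx₁, hx₂, hlt, hδ, hle⟩ := exists_Icc_le_neg haC ha_neg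
  have hmid : a ((x₁ + x₂) / 2) ≠ 0 := by
    have := hle ((x₁ + x₂) / 2) ⟨by linarith, by linarith⟩
    linarith
  have huniq : ∀ {Y Z : ℝ → ℝ × ℝ}, IsLogSol ν a Y → IsLogSol ν a Z →
      ∀ x ∈ Icc (0:ℝ) 1, (Y x).1 = (Z x).1 := fun hY hZ =>
    IsLogSol.eq_of_ne_zero hν ⟨by linarith, by linarith⟩ hmid hY hZ
  have hsub : ∀ {ns : ℕ → ℕ}, Tendsto ns atTop atTop → _ := fun hns =>
    exists_subseq_tendstoUniformlyOn_isLogSol hν hA_conv haC (fun n => (hU n).isLogSol hν) hR hns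
  obtain ⟨-, Z, hZ, -⟩ := hsub tendsto_id
  refine ⟨_, _, _, hZ.posSol hν haC, fun v v' v'' hv x hx => ?_, ?_⟩
  · rw [← huniq (hv.isLogSol hν) hZ x hx, Real.exp_log (hv.2.1 x hx)]
  · by_contra hnot
    simp only [Metric.tendstoUniformlyOn_iff, not_forall, exists_prop] at hnot
    obtain ⟨ε, hε, hfreq⟩ := hnot
    obtain ⟨ns, hns, hfar⟩ := extraction_of_frequently_atTop (not_eventually.1 hfreq)
    obtain ⟨ms, W, hW, hlim⟩ := hsub hns.tendsto_atTop
    obtain ⟨k, hk⟩ := (Metric.tendstoUniformlyOn_iff.1 hlim ε hε).exists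
    refine hfar (ms k) fun x hx => ?_
    have h := hk x hx
    rwa [Real.exp_log ((hU _).2.1 x hx), huniq hW hZ x hx] at h
end

section
/- Let ν > 0, let a, f, u₀ : ℝ → ℝ be smooth on [0,1] with f ≥ 0 and u₀ ≥ 0 on [0,1]. Let u, v : [0,∞) × [0,1] → ℝ be continuous, C¹ in t and C² in x on (0,∞) × [0,1], both nonnegative, both satisfying ∂ₜw(t,x) − ν ∂ₓₓw(t,x) + (1/2)(∂ₓw(t,x))² = a(x) w(t,x) + f(x) for all t > 0 and x ∈ [0,1], the Neumann conditions ∂ₓw(t,0) = ∂ₓw(t,1) = 0 for all t > 0, and the initial condition w(0,x) = u₀(x) for all x ∈ [0,1], with all first and second derivatives continuous up to and bounded on [0,T] × [0,1] for every T > 0. Then u = v on [0,∞) × [0,1]. -/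
open Set

/-- `u` (with time derivative `ut`, spatial derivatives `ux`, `uxx`) is a nonnegative solution of
the Cauchy problem `∂ₜu - ν ∂ₓₓu + (1/2)(∂ₓu)² = a u + f` on `(0,∞) × [0,1]` with homogeneous
Neumann boundary conditions and initial datum `u₀`. -/
structure ParaSol (ν : ℝ) (a f u₀ : ℝ → ℝ) (u ut ux uxx : ℝ → ℝ → ℝ) : Prop where
  cont : ContinuousOn (fun p : ℝ × ℝ => u p.1 p.2) (Ici (0:ℝ) ×ˢ Icc (0:ℝ) 1)
  nonneg : ∀ t ∈ Ici (0:ℝ), ∀ x ∈ Icc (0:ℝ) 1, 0 ≤ u t x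
  hdt : ∀ t > (0:ℝ), ∀ x ∈ Icc (0:ℝ) 1, HasDerivAt (fun s => u s x) (ut t x) t
  hdx : ∀ t > (0:ℝ), ∀ x ∈ Icc (0:ℝ) 1, HasDerivAt (fun y => u t y) (ux t x) x
  hdxx : ∀ t > (0:ℝ), ∀ x ∈ Icc (0:ℝ) 1, HasDerivAt (fun y => ux t y) (uxx t x) x
  eqn : ∀ t > (0:ℝ), ∀ x ∈ Icc (0:ℝ) 1,
    ut t x - ν * uxx t x + (1/2) * (ux t x)^2 = a x * u t x + f x
  neumann0 : ∀ t > (0:ℝ), ux t 0 = 0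
  neumann1 : ∀ t > (0:ℝ), ux t 1 = 0
  init : ∀ x ∈ Icc (0:ℝ) 1, u 0 x = u₀ x

/-- The first and second derivatives of `u` are continuous up to, and bounded on,
`[0,T] × [0,1]` for every `T > 0`. -/
def DerivsBdd (ut ux uxx : ℝ → ℝ → ℝ) : Prop :=
  ∀ T > (0:ℝ),
    (ContinuousOn (fun p : ℝ × ℝ => ut p.1 p.2) (Icc 0 T ×ˢ Icc (0:ℝ) 1) ∧
     ContinuousOn (fun p : ℝ × ℝ => ux p.1 p.2) (Icc 0 T ×ˢ Icc (0:ℝ) 1) ∧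
     ContinuousOn (fun p : ℝ × ℝ => uxx p.1 p.2) (Icc 0 T ×ˢ Icc (0:ℝ) 1)) ∧
    ∃ C : ℝ, ∀ t ∈ Icc (0:ℝ) T, ∀ x ∈ Icc (0:ℝ) 1,
      |ut t x| ≤ C ∧ |ux t x| ≤ C ∧ |uxx t x| ≤ C

/-- A function differentiable at `t` whose value at `t` dominates its values on `[a, t]` has
nonnegative derivative at `t`. -/
lemma deriv_nonneg_of_le_on_left {g : ℝ → ℝ} {g' a t : ℝ} (hat : a < t)
    (hg : HasDerivAt g g' t) (hmax : ∀ s ∈ Icc a t, g s ≤ g t) : 0 ≤ g' := by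
  have hslope : Filter.Tendsto (slope g t) (nhdsWithin t (Iio t)) (nhds g') :=
    (hasDerivAt_iff_tendsto_slope.1 hg).mono_left
      (nhdsWithin_mono t fun y (hy : y < t) => hy.ne)
  refine ge_of_tendsto hslope ?_
  filter_upwards [Ioo_mem_nhdsLT hat] with s hs
  rw [slope_def_field]
  exact div_nonneg_of_nonpos (sub_nonpos.2 (hmax s ⟨hs.1.le, hs.2.le⟩)) (sub_nonpos.2 hs.2.le)

/-- At a maximum point over `[a, b]` that is a critical point, possibly on the boundary, the second
derivative is nonpositive. -/
lemma second_deriv_nonpos_of_isMaxOn {g g₁ : ℝ → ℝ} {a b x g₂ : ℝ} (hab : a < b)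
    (hx : x ∈ Icc a b) (hmax : ∀ y ∈ Icc a b, g y ≤ g x)
    (hg : ∀ y ∈ Icc a b, HasDerivAt g (g₁ y) y) (hg₁ : HasDerivAt g₁ g₂ x)
    (hcrit : g₁ x = 0) : g₂ ≤ 0 := by
  by_contra! hpos
  have hslope := (hasDerivAt_iff_tendsto_slope.1 hg₁).eventually (lt_mem_nhds hpos)
  rw [eventually_nhdsWithin_iff, Metric.eventually_nhds_iff] at hslope
  obtain ⟨δ, hδ, hball⟩ := hslope
  have hsub : ∀ {c d}, c ∈ Icc a b → d ∈ Icc a b → ∀ y ∈ Icc c d, y ∈ Icc a b :=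
    fun hc hd y hy => ⟨hc.1.trans hy.1, hy.2.trans hd.2⟩
  rcases hx.2.lt_or_eq with hxb | rfl
  · have hxy : x < min b (x + δ / 2) := lt_min hxb (by linarith)
    have hy : min b (x + δ / 2) ∈ Icc a b := ⟨hx.1.trans hxy.le, min_le_left _ _⟩
    have hyδ : min b (x + δ / 2) ≤ x + δ / 2 := min_le_right _ _
    generalize min b (x + δ / 2) = y at hxy hy hyδ
    obtain ⟨c, hc, hceq⟩ := exists_hasDerivAt_eq_slope g g₁ hxy
      (fun z hz => (hg z (hsub hx hy z hz)).continuousAt.continuousWithinAt)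
      (fun z hz => hg z (hsub hx hy z (Ioo_subset_Icc_self hz)))
    have hs := hball (y := c) (by rw [Real.dist_eq, abs_lt]; constructor <;> linarith [hc.1, hc.2])
      hc.1.ne'
    rw [slope_def_field, hcrit, sub_zero] at hs
    have hnonpos : g₁ c ≤ 0 :=
      hceq ▸ div_nonpos_of_nonpos_of_nonneg (sub_nonpos.2 (hmax y hy)) (sub_nonneg.2 hxy.le)
    exact hs.not_ge (div_nonpos_of_nonpos_of_nonneg hnonpos (sub_nonneg.2 hc.1.le))
  · have hyx : max a (x - δ / 2) < x := max_lt hab (by linarith)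
    have hy : max a (x - δ / 2) ∈ Icc a x := ⟨le_max_left _ _, hyx.le⟩
    have hyδ : x - δ / 2 ≤ max a (x - δ / 2) := le_max_right _ _
    generalize max a (x - δ / 2) = y at hyx hy hyδ
    obtain ⟨c, hc, hceq⟩ := exists_hasDerivAt_eq_slope g g₁ hyx
      (fun z hz => (hg z (hsub hy hx z hz)).continuousAt.continuousWithinAt)
      (fun z hz => hg z (hsub hy hx z (Ioo_subset_Icc_self hz)))
    have hs := hball (y := c) (by rw [Real.dist_eq, abs_lt]; constructor <;> linarith [hc.1, hc.2])
      hc.2.ne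
    rw [slope_def_field, hcrit, sub_zero] at hs
    have hnonneg : 0 ≤ g₁ c :=
      hceq ▸ div_nonneg (sub_nonneg.2 (hmax y hy)) (sub_nonneg.2 hyx.le)
    exact hs.not_ge (div_nonpos_of_nonneg_of_nonpos hnonneg (sub_nonpos.2 hc.2.le))

/-- Comparison of two solutions with the same data, by the maximum principle applied to
`exp (-(A + 1) t) (u - v)` with `A` an upper bound of `a`. -/
lemma ParaSol.le {ν : ℝ} (hν : 0 < ν) {a f u₀ : ℝ → ℝ} (ha : ContinuousOn a (Icc (0:ℝ) 1))
    {u ut ux uxx v vt vx vxx : ℝ → ℝ → ℝ}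
    (hu : ParaSol ν a f u₀ u ut ux uxx) (hv : ParaSol ν a f u₀ v vt vx vxx) :
    ∀ t ∈ Ici (0:ℝ), ∀ x ∈ Icc (0:ℝ) 1, u t x ≤ v t x := by
  intro T hT X hX
  by_contra! hlt
  obtain ⟨A, hA⟩ := (isCompact_Icc.image_of_continuousOn ha).bddAbove
  have hA : ∀ x ∈ Icc (0:ℝ) 1, a x ≤ A := fun x hx => hA (mem_image_of_mem a hx)
  have hcont : ContinuousOn
      (fun p : ℝ × ℝ => Real.exp (-(A + 1) * p.1) * (u p.1 p.2 - v p.1 p.2))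
      (Icc 0 T ×ˢ Icc (0:ℝ) 1) :=
    (by fun_prop : Continuous fun p : ℝ × ℝ => Real.exp (-(A + 1) * p.1)).continuousOn.mul
      ((hu.cont.sub hv.cont).mono (prod_mono Icc_subset_Ici_self Subset.rfl))
  obtain ⟨⟨t, x⟩, ⟨ht, hx⟩, hmax⟩ := (isCompact_Icc.prod isCompact_Icc).exists_isMaxOn
    ⟨(T, X), ⟨hT, le_rfl⟩, hX⟩ hcont
  have hmax : ∀ s ∈ Icc 0 T, ∀ y ∈ Icc (0:ℝ) 1,
      Real.exp (-(A + 1) * s) * (u s y - v s y) ≤ Real.exp (-(A + 1) * t) * (u t x - v t x) :=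
    fun s hs y hy => hmax (show (s, y) ∈ Icc 0 T ×ˢ Icc (0:ℝ) 1 from ⟨hs, hy⟩)
  dsimp only at ht hx
  have hexp := Real.exp_pos (-(A + 1) * t)
  have hw : 0 < u t x - v t x := by
    refine pos_of_mul_pos_right (lt_of_lt_of_le ?_ (hmax T ⟨hT, le_rfl⟩ X hX)) hexp.le
    exact mul_pos (Real.exp_pos _) (sub_pos.2 hlt)
  have ht0 : 0 < t := ht.1.lt_of_ne (by
    rintro rfl
    rw [hu.init x hx, hv.init x hx, sub_self] at hw
    exact hw.false)
  have hxmax : ∀ y ∈ Icc (0:ℝ) 1, u t y - v t y ≤ u t x - v t x :=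
    fun y hy => le_of_mul_le_mul_left (hmax t ht y hy) hexp
  have hcrit : ux t x - vx t x = 0 := by
    rcases hx.1.eq_or_lt with rfl | hx0
    · rw [hu.neumann0 t ht0, hv.neumann0 t ht0, sub_self]
    rcases hx.2.eq_or_lt with rfl | hx1
    · rw [hu.neumann1 t ht0, hv.neumann1 t ht0, sub_self]
    have hloc : IsLocalMax (fun y => u t y - v t y) x :=
      Filter.mem_of_superset (Icc_mem_nhds hx0 hx1) hxmax
    exact hloc.hasDerivAt_eq_zero ((hu.hdx t ht0 x hx).sub (hv.hdx t ht0 x hx))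
  have hxx : uxx t x - vxx t x ≤ 0 :=
    second_deriv_nonpos_of_isMaxOn (g := fun y => u t y - v t y)
      (g₁ := fun y => ux t y - vx t y) zero_lt_one hx hxmax
      (fun y hy => (hu.hdx t ht0 y hy).sub (hv.hdx t ht0 y hy))
      ((hu.hdxx t ht0 x hx).sub (hv.hdxx t ht0 x hx)) hcrit
  have hderiv := (((hasDerivAt_id t).const_mul (-(A + 1))).exp).mul
    ((hu.hdt t ht0 x hx).sub (hv.hdt t ht0 x hx))
  have htime := deriv_nonneg_of_le_on_left ht0 hderiv
    (fun s hs => hmax s ⟨hs.1, hs.2.trans ht.2⟩ x hx)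
  have htime : 0 ≤ (ut t x - vt t x) - (A + 1) * (u t x - v t x) := by
    refine nonneg_of_mul_nonneg_right (htime.trans_eq ?_) hexp
    simp only [id, Pi.sub_apply]
    ring
  have heqn : ut t x - vt t x = ν * (uxx t x - vxx t x) + a x * (u t x - v t x) := by
    have hux : ux t x = vx t x := sub_eq_zero.1 hcrit
    have hequ := hu.eqn t ht0 x hx
    have heqv := hv.eqn t ht0 x hx
    rw [hux] at hequ
    linarith
  have hdiff : ν * (uxx t x - vxx t x) ≤ 0 := mul_nonpos_of_nonneg_of_nonpos hν.le hxx
  have hreact : a x * (u t x - v t x) ≤ A * (u t x - v t x) :=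
    mul_le_mul_of_nonneg_right (hA x hx) hw.le
  linarith

/-- Uniqueness part of Theorem 3.11: two smooth nonnegative solutions of the Cauchy problem
with the same data coincide. -/
theorem stmt_16 (ν : ℝ) (hν : 0 < ν) (a f u₀ : ℝ → ℝ)
    (ha_smooth : ContDiffOn ℝ (⊤ : ℕ∞) a (Icc (0:ℝ) 1))
    (hf_smooth : ContDiffOn ℝ (⊤ : ℕ∞) f (Icc (0:ℝ) 1))
    (hu₀_smooth : ContDiffOn ℝ (⊤ : ℕ∞) u₀ (Icc (0:ℝ) 1))
    (hf_nonneg : ∀ x ∈ Icc (0:ℝ) 1, 0 ≤ f x)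
    (hu₀_nonneg : ∀ x ∈ Icc (0:ℝ) 1, 0 ≤ u₀ x)
    (u ut ux uxx v vt vx vxx : ℝ → ℝ → ℝ)
    (hu : ParaSol ν a f u₀ u ut ux uxx) (hu_bdd : DerivsBdd ut ux uxx)
    (hv : ParaSol ν a f u₀ v vt vx vxx) (hv_bdd : DerivsBdd vt vx vxx) :
    ∀ t ∈ Ici (0:ℝ), ∀ x ∈ Icc (0:ℝ) 1, u t x = v t x := by
  intro t ht x hx
  exact le_antisymm (hu.le hν ha_smooth.continuousOn hv t ht x hx)
    (hv.le hν ha_smooth.continuousOn hu t ht x hx)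
end

section
/- Let ν > 0, let a, f, u₀ : ℝ → ℝ be smooth on [0,1] with f ≥ 0 and u₀ ≥ 0 on [0,1], and assume f is not identically zero on [0,1] or u₀ is not identically zero on [0,1]. Let u : [0,∞) × [0,1] → ℝ be continuous, C¹ in t and C² in x on (0,∞) × [0,1], nonnegative, satisfying ∂ₜu(t,x) − ν ∂ₓₓu(t,x) + (1/2)(∂ₓu(t,x))² = a(x) u(t,x) + f(x) for all t > 0 and x ∈ [0,1], ∂ₓu(t,0) = ∂ₓu(t,1) = 0 for all t > 0, and u(0,x) = u₀(x) for all x ∈ [0,1]. Then u(t,x) > 0 for every t > 0 and every x ∈ (0,1). -/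
open Set

open Filter Topology

/-- At a minimum from the left, the derivative is nonpositive. -/
lemma HasDerivAt.nonpos_of_left_min {g : ℝ → ℝ} {g' t : ℝ} (hg : HasDerivAt g g' t)
    (hmin : ∀ᶠ s in 𝓝[<] t, g t ≤ g s) : g' ≤ 0 := by
  have h := (hasDerivAt_iff_tendsto_slope.mp hg).mono_left
    (nhdsWithin_mono t (s := Set.Iio t) fun _ hs => ne_of_lt hs)
  refine le_of_tendsto h ?_
  filter_upwards [hmin, self_mem_nhdsWithin] with s hs (hst : s < t)
  rw [slope_def_field]
  exact div_nonpos_of_nonneg_of_nonpos (by linarith) (by linarith)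

/-- At a local minimum, the second derivative is nonnegative. -/
lemma IsLocalMin.second_deriv_nonneg {g g' : ℝ → ℝ} {g'' x : ℝ} (hmin : IsLocalMin g x)
    (hg : ∀ᶠ y in 𝓝 x, HasDerivAt g (g' y) y) (hg' : HasDerivAt g' g'' x) : 0 ≤ g'' := by
  have hd : deriv g =ᶠ[𝓝 x] g' := hg.mono fun y hy => hy.deriv
  have hdd : deriv (deriv g) x = g'' := hd.deriv_eq.trans hg'.deriv
  by_contra! hneg
  have hmax : IsLocalMax g x := isLocalMax_of_deriv_deriv_neg (by rwa [hdd]) hmin.deriv_eq_zero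
    hg.self_of_nhds.continuousAt
  have hconst : g =ᶠ[𝓝 x] fun _ => g x := by
    filter_upwards [hmin, hmax] with y h₁ h₂ using le_antisymm h₂ h₁
  have hzero : deriv (deriv g) x = 0 := by
    rw [hconst.deriv.deriv_eq]
    simp
  linarith

/-- A nonzero value on `[0,1]` of a continuous function forces one on `(0,1)`. -/
lemma exists_Ioo_ne_zero {g : ℝ → ℝ} (hg : ContinuousOn g (Icc (0:ℝ) 1))
    (h : ∃ x ∈ Icc (0:ℝ) 1, g x ≠ 0) : ∃ x ∈ Ioo (0:ℝ) 1, g x ≠ 0 := by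
  by_contra! hz
  obtain ⟨x, hx, hgx⟩ := h
  have hcl : closure (Ioo (0:ℝ) 1) = Icc 0 1 := closure_Ioo zero_ne_one
  have heq : EqOn g (fun _ => 0) (Icc (0:ℝ) 1) :=
    EqOn.of_subset_closure (s := Ioo (0:ℝ) 1) (fun y hy => hz y hy) hg continuousOn_const
      Ioo_subset_Icc_self hcl.ge
  exact hgx (heq hx)

/-- Moving bump `exp (-k (t - t₀)) (r² - (x - x₀ - b (t - t₀))²)²`, used as a subsolution. -/
noncomputable def bump (k r b t₀ x₀ t x : ℝ) : ℝ :=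
  Real.exp (-k * (t - t₀)) * (r ^ 2 - (x - x₀ - b * (t - t₀)) ^ 2) ^ 2

section bump

variable (k r b t₀ x₀ t x : ℝ)

lemma hasDerivAt_bump_time :
    HasDerivAt (fun s => bump k r b t₀ x₀ s x)
      (Real.exp (-k * (t - t₀)) * (-k * (r ^ 2 - (x - x₀ - b * (t - t₀)) ^ 2) ^ 2
        + 4 * b * (x - x₀ - b * (t - t₀)) * (r ^ 2 - (x - x₀ - b * (t - t₀)) ^ 2))) t := by
  have hs : HasDerivAt (fun s : ℝ => s - t₀) 1 t := (hasDerivAt_id t).sub_const t₀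
  have hy := (hs.const_mul b).const_sub (x - x₀)
  have hq := ((hy.pow 2).const_sub (r ^ 2)).pow 2
  refine ((hs.const_mul (-k)).exp.mul hq).congr_deriv ?_
  simp only [Pi.pow_apply]
  ring

lemma hasDerivAt_bump_space :
    HasDerivAt (fun y => bump k r b t₀ x₀ t y)
      (Real.exp (-k * (t - t₀)) * (-4 * (x - x₀ - b * (t - t₀)) *
        (r ^ 2 - (x - x₀ - b * (t - t₀)) ^ 2))) x := by
  have hy := ((hasDerivAt_id x).sub_const x₀).sub_const (b * (t - t₀))
  have hq := ((hy.pow 2).const_sub (r ^ 2)).pow 2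
  refine (hq.const_mul (Real.exp (-k * (t - t₀)))).congr_deriv ?_
  simp only [Pi.pow_apply, id_eq]
  ring

lemma hasDerivAt_bump_space_space :
    HasDerivAt (fun y => Real.exp (-k * (t - t₀)) * (-4 * (y - x₀ - b * (t - t₀)) *
        (r ^ 2 - (y - x₀ - b * (t - t₀)) ^ 2)))
      (Real.exp (-k * (t - t₀)) * (-4 * (r ^ 2 - (x - x₀ - b * (t - t₀)) ^ 2)
        + 8 * (x - x₀ - b * (t - t₀)) ^ 2)) x := by
  have hy := ((hasDerivAt_id x).sub_const x₀).sub_const (b * (t - t₀))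
  have hq := (hy.pow 2).const_sub (r ^ 2)
  refine (((hy.const_mul (-4)).mul hq).const_mul (Real.exp (-k * (t - t₀)))).congr_deriv ?_
  simp only [Pi.pow_apply, id_eq]
  ring

end bump

/-- The algebraic inequality making the bump a strict subsolution: `E` is the exponential factor
and `y` the displacement from the moving centre. -/
lemma bump_strict_subsolution {ν M b r k ε E y : ℝ} (hν : 0 < ν) (hr : 0 < r)
    (hk : k = M + 8 * r ^ 2 + (4 * r * |b| + 12 * ν) ^ 2 / (8 * ν * r ^ 2))
    (hε : 0 < ε) (hε1 : ε ≤ 1) (hE : 0 < E) (hE1 : E ≤ 1) (hy : y ^ 2 < r ^ 2) :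
    ε * (E * (-k * (r ^ 2 - y ^ 2) ^ 2 + 4 * b * y * (r ^ 2 - y ^ 2)))
      - ν * (ε * (E * (-4 * (r ^ 2 - y ^ 2) + 8 * y ^ 2)))
      + (1 / 2) * (ε * (E * (-4 * y * (r ^ 2 - y ^ 2)))) ^ 2
      + M * (ε * (E * (r ^ 2 - y ^ 2) ^ 2)) < 0 := by
  obtain ⟨q, hqd⟩ : ∃ q, q = r ^ 2 - y ^ 2 := ⟨_, rfl⟩
  have hq : 0 < q := by rw [hqd]; linarith
  set B := 4 * r * |b| + 12 * ν with hB
  set A := 8 * ν * r ^ 2 with hA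
  have hApos : 0 < A := by positivity
  have hby : 4 * b * y + 12 * ν ≤ B := by
    have h₁ : b * y ≤ |b| * |y| := by rw [← abs_mul]; exact le_abs_self _
    have h₂ : |y| ≤ r := (abs_lt_of_sq_lt_sq hy hr.le).le
    have h₃ := mul_le_mul_of_nonneg_left h₂ (abs_nonneg b)
    rw [hB]; linarith
  have hquad : 0 < B ^ 2 / A * q ^ 2 - B * q + A := by
    have h : B ^ 2 / A * q ^ 2 - B * q + A = ((B * q) ^ 2 - B * q * A + A ^ 2) / A := by
      field_simp
    rw [h]
    apply div_pos _ hApos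
    nlinarith [sq_nonneg (B * q - A / 2), sq_pos_of_pos hApos]
  have hgrad : ε * E * (8 * y ^ 2 * q ^ 2) ≤ 8 * r ^ 2 * q ^ 2 := by
    have h₁ : ε * E ≤ 1 := mul_le_one₀ hε1 hE.le hE1
    have h₂ : 8 * y ^ 2 * q ^ 2 ≤ 8 * r ^ 2 * q ^ 2 := by gcongr
    calc _ ≤ 1 * (8 * y ^ 2 * q ^ 2) := by gcongr
      _ ≤ _ := by linarith
  have hbq := mul_le_mul_of_nonneg_right hby hq.le
  have hAq : 8 * ν * y ^ 2 = A - 8 * ν * q := by rw [hA, hqd]; ring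
  have hbr : -k * q ^ 2 + 4 * b * y * q - ν * (-4 * q + 8 * y ^ 2)
      + ε * E * (8 * y ^ 2 * q ^ 2) + M * q ^ 2 < 0 := by
    rw [hk]
    linarith
  have hmul := mul_neg_of_pos_of_neg (mul_pos hε hE) hbr
  rw [← hqd]
  linarith

/-- Positivity of a solution at an interior point propagates to every interior point at every
later time. -/
lemma ParaSol.pos_of_pos {ν M : ℝ} {a f u₀ : ℝ → ℝ} {u ut ux uxx : ℝ → ℝ → ℝ}
    (hu : ParaSol ν a f u₀ u ut ux uxx) (hν : 0 < ν)
    (ha : ∀ x ∈ Icc (0:ℝ) 1, -M ≤ a x) (hf : ∀ x ∈ Icc (0:ℝ) 1, 0 ≤ f x) (hM : 0 ≤ M)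
    {t₀ t₁ x₀ x₁ : ℝ} (ht₀ : 0 ≤ t₀) (ht : t₀ < t₁) (hx₀ : x₀ ∈ Ioo (0:ℝ) 1)
    (hx₁ : x₁ ∈ Ioo (0:ℝ) 1) (hpos : 0 < u t₀ x₀) : 0 < u t₁ x₁ := by
  obtain ⟨r, hr, hrx, c, hc, hcu⟩ : ∃ r > 0, (r < x₀ ∧ r < 1 - x₀ ∧ r < x₁ ∧ r < 1 - x₁) ∧
      ∃ c > 0, ∀ x ∈ Icc (0:ℝ) 1, |x - x₀| ≤ r → c ≤ u t₀ x := by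
    have hcont : ContinuousAt (u t₀) x₀ := by
      have h : ContinuousOn (u t₀) (Icc (0:ℝ) 1) :=
        hu.cont.comp (f := fun x : ℝ => (t₀, x)) (by fun_prop) (fun x hx => ⟨ht₀, hx⟩)
      exact h.continuousAt (Icc_mem_nhds hx₀.1 hx₀.2)
    obtain ⟨δ, hδ, hball⟩ := Metric.eventually_nhds_iff.mp
      (hcont.eventually (lt_mem_nhds (half_lt_self hpos)))
    obtain ⟨h₁, h₂⟩ := hx₀
    obtain ⟨h₃, h₄⟩ := hx₁
    obtain ⟨r, hr, hlt⟩ := exists_between (show 0 < min δ (min (min x₀ (1 - x₀))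
      (min x₁ (1 - x₁))) by simp only [lt_min_iff, sub_pos]; exact ⟨hδ, ⟨h₁, h₂⟩, h₃, h₄⟩)
    simp only [lt_min_iff] at hlt
    refine ⟨r, hr, ⟨hlt.2.1.1, hlt.2.1.2, hlt.2.2.1, hlt.2.2.2⟩, u t₀ x₀ / 2, by positivity,
      fun x _ hxr => (hball ?_).le⟩
    rw [Real.dist_eq]
    linarith [hlt.1]
  obtain ⟨hr₁, hr₂, hr₃, hr₄⟩ := hrx
  have hτ : 0 < t₁ - t₀ := sub_pos.mpr ht
  set b := (x₁ - x₀) / (t₁ - t₀) with hb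
  have hbτ : b * (t₁ - t₀) = x₁ - x₀ := div_mul_cancel₀ _ hτ.ne'
  set k := M + 8 * r ^ 2 + (4 * r * |b| + 12 * ν) ^ 2 / (8 * ν * r ^ 2) with hk
  have hk0 : 0 ≤ k := by positivity
  set ε := min 1 (c / r ^ 4) with hεd
  have hε : 0 < ε := by rw [hεd]; positivity
  have hε1 : ε ≤ 1 := min_le_left _ _
  have hεc : ε * r ^ 4 ≤ c := by
    have h : ε ≤ c / r ^ 4 := min_le_right _ _
    rwa [le_div_iff₀ (by positivity)] at h
  set v := bump k r b t₀ x₀ with hv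
  set D : Set (ℝ × ℝ) := (Icc t₀ t₁ ×ˢ Icc (0:ℝ) 1) ∩
    {p | (p.2 - x₀ - b * (p.1 - t₀)) ^ 2 ≤ r ^ 2} with hD
  have hDc : IsCompact D := (isCompact_Icc.prod isCompact_Icc).inter_right
    (isClosed_le (by fun_prop) continuous_const)
  have hmem₁ : (t₁, x₁) ∈ D := by
    refine ⟨⟨⟨ht.le, le_rfl⟩, hx₁.1.le, hx₁.2.le⟩, ?_⟩
    simp only [mem_ofPred_eq, hbτ, sub_self, zero_pow two_ne_zero]
    positivity
  have hvcont : Continuous (fun p : ℝ × ℝ => v p.1 p.2) := by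
    simp only [hv, bump]
    fun_prop
  have hgcont : ContinuousOn (fun p : ℝ × ℝ => u p.1 p.2 - ε * v p.1 p.2) D :=
    (hu.cont.mono fun p hp => ⟨ht₀.trans hp.1.1.1, hp.1.2⟩).sub
      (continuous_const.mul hvcont).continuousOn
  obtain ⟨⟨t, x⟩, ⟨⟨htI, hxI⟩, hxr⟩, hmin⟩ := hDc.exists_isMinOn ⟨_, hmem₁⟩ hgcont
  have hmin' : ∀ s y, (s, y) ∈ D → u t x - ε * v t x ≤ u s y - ε * v s y :=
    fun s y h => hmin h
  simp only [mem_ofPred_eq] at htI hxI hxr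
  suffices hge : 0 ≤ u t x - ε * v t x by
    have h := hmin' _ _ hmem₁
    have hv₁ : 0 < v t₁ x₁ := by
      simp only [hv, bump, hbτ, sub_self, zero_pow two_ne_zero, sub_zero]
      positivity
    have := mul_pos hε hv₁
    linarith
  by_contra! hneg
  have htpos : 0 ≤ t := ht₀.trans htI.1
  have hu0 : 0 ≤ u t x := hu.nonneg t htpos x hxI
  have hxlt : (x - x₀ - b * (t - t₀)) ^ 2 < r ^ 2 := by
    refine lt_of_le_of_ne hxr fun heq => ?_
    have : v t x = 0 := by simp [hv, bump, heq]
    rw [this] at hneg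
    linarith
  have htlt : t₀ < t := by
    refine lt_of_le_of_ne htI.1 fun heq => ?_
    subst heq
    simp only [sub_self, mul_zero, sub_zero] at hxr
    have hcx := hcu x hxI (abs_le_of_sq_le_sq hxr hr.le)
    have hvle : v t₀ x ≤ r ^ 4 := by
      simp only [hv, bump, sub_self, mul_zero, sub_zero, Real.exp_zero, one_mul]
      nlinarith [sq_nonneg (x - x₀)]
    have := mul_le_mul_of_nonneg_left hvle hε.le
    linarith
  have ht0 : 0 < t := ht₀.trans_lt htlt
  have hxIoo : x ∈ Ioo (0:ℝ) 1 := by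
    have habs := abs_lt.mp (abs_lt_of_sq_lt_sq hxlt hr.le)
    have hθ₀ : 0 ≤ (t - t₀) / (t₁ - t₀) := div_nonneg (by linarith) hτ.le
    have hθ₁ : (t - t₀) / (t₁ - t₀) ≤ 1 := (div_le_one hτ).mpr (by linarith [htI.2])
    have hbt : b * (t - t₀) = (x₁ - x₀) * ((t - t₀) / (t₁ - t₀)) := by rw [hb]; ring
    rw [hbt] at habs
    constructor <;> nlinarith
  have hE1 : Real.exp (-k * (t - t₀)) ≤ 1 := by
    rw [Real.exp_le_one_iff]
    nlinarith
  have hsub := bump_strict_subsolution (M := M) hν hr hk hε hε1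
    (Real.exp_pos (-k * (t - t₀))) hE1 hxlt
  have hcenter : ∀ {s y : ℝ}, (y - x₀ - b * (s - t₀)) ^ 2 < r ^ 2 → s ∈ Icc t₀ t₁ →
      y ∈ Icc (0:ℝ) 1 → (s, y) ∈ D := fun h hs hy => ⟨⟨hs, hy⟩, h.le⟩
  have htime := ((hu.hdt t ht0 x hxI).sub
    ((hasDerivAt_bump_time k r b t₀ x₀ t x).const_mul ε)).nonpos_of_left_min (by
      have hopen : ∀ᶠ s in 𝓝 t, (x - x₀ - b * (s - t₀)) ^ 2 < r ^ 2 :=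
        (show Continuous fun s : ℝ => (x - x₀ - b * (s - t₀)) ^ 2 by
          fun_prop).continuousAt.eventually
          (gt_mem_nhds hxlt)
      filter_upwards [nhdsWithin_le_nhds hopen, nhdsWithin_le_nhds (lt_mem_nhds htlt),
        self_mem_nhdsWithin] with s h₁ h₂ (h₃ : s < t)
      exact hmin' s x (hcenter h₁ ⟨h₂.le, h₃.le.trans htI.2⟩ hxI))
  have hspace : IsLocalMin (fun y => u t y - ε * v t y) x := by
    have hopen : ∀ᶠ y in 𝓝 x, (y - x₀ - b * (t - t₀)) ^ 2 < r ^ 2 :=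
      (show Continuous fun y : ℝ => (y - x₀ - b * (t - t₀)) ^ 2 by
          fun_prop).continuousAt.eventually
        (gt_mem_nhds hxlt)
    filter_upwards [hopen, Icc_mem_nhds hxIoo.1 hxIoo.2] with y h₁ h₂
    exact hmin' t y (hcenter h₁ htI h₂)
  have hd : ∀ y ∈ Icc (0:ℝ) 1, HasDerivAt (fun y => u t y - ε * v t y) _ y := fun y hy =>
    (hu.hdx t ht0 y hy).sub ((hasDerivAt_bump_space k r b t₀ x₀ t y).const_mul ε)
  have hgrad := hspace.hasDerivAt_eq_zero (hd x hxI)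
  have hsecond := hspace.second_deriv_nonneg
    (eventually_of_mem (Icc_mem_nhds hxIoo.1 hxIoo.2) hd)
    ((hu.hdxx t ht0 x hxI).sub ((hasDerivAt_bump_space_space k r b t₀ x₀ t x).const_mul ε))
  have heqn := hu.eqn t ht0 x hxI
  rw [sub_eq_zero.mp hgrad] at heqn
  have hau := mul_le_mul_of_nonneg_right (ha x hxI) hu0
  have hfx := hf x hxI
  have hMu := mul_le_mul_of_nonneg_left hneg.le hM
  have hνs := mul_nonneg hν.le hsecond
  simp only [hv, bump] at hMu
  linarith

/-- A solution is positive at positive times wherever the source is nonzero. -/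
lemma ParaSol.pos_of_source_pos {ν : ℝ} {a f u₀ : ℝ → ℝ} {u ut ux uxx : ℝ → ℝ → ℝ}
    (hu : ParaSol ν a f u₀ u ut ux uxx) (hν : 0 < ν) {t x : ℝ} (ht : 0 < t)
    (hx : x ∈ Ioo (0:ℝ) 1) (hf : 0 < f x) : 0 < u t x := by
  have hxI := Ioo_subset_Icc_self hx
  refine lt_of_le_of_ne (hu.nonneg t ht.le x hxI) fun hzero => ?_
  have hnhds : Icc (0:ℝ) 1 ∈ 𝓝 x := Icc_mem_nhds hx.1 hx.2
  have hmin : IsLocalMin (u t) x := by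
    filter_upwards [hnhds] with y hy
    rw [← hzero]
    exact hu.nonneg t ht.le y hy
  have htime : ut t x ≤ 0 := (hu.hdt t ht x hxI).nonpos_of_left_min (by
    filter_upwards [nhdsWithin_le_nhds (lt_mem_nhds ht)] with s hs
    rw [← hzero]
    exact hu.nonneg s hs.le x hxI)
  have hsecond := hmin.second_deriv_nonneg
    (eventually_of_mem hnhds (hu.hdx t ht)) (hu.hdxx t ht x hxI)
  have hgrad : ux t x = 0 := hmin.hasDerivAt_eq_zero (hu.hdx t ht x hxI)
  have heqn := hu.eqn t ht x hxI
  rw [hgrad, ← hzero] at heqn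
  have := mul_nonneg hν.le hsecond
  linarith

/-- Strict positivity assertion of Theorem 3.11: if the data `f`, `u₀` are not both identically
zero, then the nonnegative solution of the Cauchy problem is strictly positive for all positive
times. -/
theorem stmt_17 (ν : ℝ) (hν : 0 < ν) (a f u₀ : ℝ → ℝ)
    (ha_smooth : ContDiffOn ℝ (⊤ : ℕ∞) a (Icc (0:ℝ) 1))
    (hf_smooth : ContDiffOn ℝ (⊤ : ℕ∞) f (Icc (0:ℝ) 1))
    (hu₀_smooth : ContDiffOn ℝ (⊤ : ℕ∞) u₀ (Icc (0:ℝ) 1))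
    (hf_nonneg : ∀ x ∈ Icc (0:ℝ) 1, 0 ≤ f x)
    (hu₀_nonneg : ∀ x ∈ Icc (0:ℝ) 1, 0 ≤ u₀ x)
    (hne : (∃ x ∈ Icc (0:ℝ) 1, f x ≠ 0) ∨ (∃ x ∈ Icc (0:ℝ) 1, u₀ x ≠ 0))
    (u ut ux uxx : ℝ → ℝ → ℝ)
    (hu : ParaSol ν a f u₀ u ut ux uxx) :
    ∀ t > (0:ℝ), ∀ x ∈ Ioo (0:ℝ) 1, 0 < u t x := by
  intro t ht x hx
  obtain ⟨C, hC⟩ := isCompact_Icc.exists_bound_of_continuousOn ha_smooth.continuousOn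
  have hC0 : 0 ≤ C := (norm_nonneg _).trans (hC x (Ioo_subset_Icc_self hx))
  have ha : ∀ y ∈ Icc (0:ℝ) 1, -C ≤ a y := fun y hy => (abs_le.mp (hC y hy)).1
  rcases hne with hne | hne
  · obtain ⟨y, hy, hfy⟩ := exists_Ioo_ne_zero hf_smooth.continuousOn hne
    have hpos := hu.pos_of_source_pos hν (half_pos ht) hy
      (lt_of_le_of_ne (hf_nonneg y (Ioo_subset_Icc_self hy)) hfy.symm)
    exact hu.pos_of_pos hν ha hf_nonneg hC0 (half_pos ht).le (half_lt_self ht) hy hx hpos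
  · obtain ⟨y, hy, huy⟩ := exists_Ioo_ne_zero hu₀_smooth.continuousOn hne
    have hyI := Ioo_subset_Icc_self hy
    have hpos : 0 < u 0 y := by
      rw [hu.init y hyI]
      exact lt_of_le_of_ne (hu₀_nonneg y hyI) huy.symm
    exact hu.pos_of_pos hν ha hf_nonneg hC0 le_rfl ht hy hx hpos
end

section
/- Let ν > 0 and let a, f, u₀ : ℝ → ℝ be smooth on [0,1] with f ≥ 0 and u₀ ≥ 0 on [0,1], and assume f is not identically zero on [0,1] or u₀ is not identically zero on [0,1]. Assume: (i) there exist λ > 0 and a C² function φ with φ(x) > 0 for all x ∈ [0,1], φ'(0) = φ'(1) = 0, and −ν φ''(x) − a(x) φ(x) = −λ φ(x) for all x ∈ [0,1]; and (ii) there exists x₀ ∈ [0,1] with a(x₀) < 0. Let ū be the unique C² function on [0,1] with ū > 0 on [0,1], ū'(0) = ū'(1) = 0, and −ν ū''(x) + (1/2) ū'(x)² = a(x) ū(x) + f(x) on [0,1]. Let u : [0,∞) × [0,1] → ℝ be continuous, C¹ in t and C² in x on (0,∞) × [0,1], nonnegative, satisfying ∂ₜu(t,x) − ν ∂ₓₓu(t,x)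 + (1/2)(∂ₓu(t,x))² = a(x) u(t,x) + f(x) for all t > 0 and x ∈ [0,1], ∂ₓu(t,0) = ∂ₓu(t,1) = 0 for all t > 0, and u(0,x) = u₀(x) for all x ∈ [0,1]. Then sup over x ∈ [0,1] of |u(T,x) − ū(x)| tends to 0 as T → ∞. -/
open Set Filter Topology

/-- Chain rule for the reflection `y ↦ -y`. -/
lemma HasDerivAt.comp_neg_id {h : ℝ → ℝ} {x c : ℝ} (hd : HasDerivAt h c (-x)) :
    HasDerivAt (fun y => h (-y)) (-c) x := by
  have := hd.comp x (hasDerivAt_neg x)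
  simp only [mul_neg, mul_one] at this
  exact this

/-- A function attaining its maximum over `[x, b]` at the left endpoint has nonpositive derivative
there. -/
lemma HasDerivAt.nonpos_of_forall_le_right {h : ℝ → ℝ} {x b c : ℝ} (hxb : x < b)
    (hd : HasDerivAt h c x) (hmax : ∀ y ∈ Ioc x b, h y ≤ h x) : c ≤ 0 := by
  have hs : Tendsto (slope h x) (𝓝[>] x) (𝓝 c) :=
    (hasDerivAt_iff_tendsto_slope.1 hd).mono_left
      (nhdsWithin_mono _ fun y (hy : x < y) => ne_of_gt hy)
  refine le_of_tendsto hs ?_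
  filter_upwards [Ioc_mem_nhdsGT hxb] with y hy
  rw [slope_def_field]
  exact div_nonpos_of_nonpos_of_nonneg (sub_nonpos.2 (hmax y hy)) (sub_nonneg.2 hy.1.le)

/-- A function attaining its maximum over `[b, x]` at the right endpoint has nonnegative derivative
there. -/
lemma HasDerivAt.nonneg_of_forall_le_left {h : ℝ → ℝ} {x b c : ℝ} (hbx : b < x)
    (hd : HasDerivAt h c x) (hmax : ∀ y ∈ Ico b x, h y ≤ h x) : 0 ≤ c := by
  have hd' : HasDerivAt (fun y => h (-y)) (-c) (-x) :=
    HasDerivAt.comp_neg_id (by rwa [neg_neg])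
  have := hd'.nonpos_of_forall_le_right (b := -b) (by linarith) fun y hy => by
    simpa using hmax (-y) ⟨by linarith [hy.2], by linarith [hy.1]⟩
  linarith

/-- One-sided second derivative test at a critical maximum over `[x, b]`. -/
lemma second_deriv_nonpos_of_max_right {h h' : ℝ → ℝ} {x b c : ℝ} (hxb : x < b)
    (hd : ∀ y ∈ Icc x b, HasDerivAt h (h' y) y) (h0 : h' x = 0) (h2 : HasDerivAt h' c x)
    (hmax : ∀ y ∈ Icc x b, h y ≤ h x) : c ≤ 0 := by
  by_contra! hc
  have hs : Tendsto (slope h' x) (𝓝[>] x) (𝓝 c) :=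
    (hasDerivAt_iff_tendsto_slope.1 h2).mono_left
      (nhdsWithin_mono _ fun y (hy : x < y) => ne_of_gt hy)
  obtain ⟨z, hz, hsub⟩ := mem_nhdsGT_iff_exists_Ioo_subset.1 (hs.eventually (lt_mem_nhds hc))
  have hxz : x < z := hz
  obtain ⟨y, hxy, hy⟩ := exists_between (lt_min hxz hxb)
  obtain ⟨hyz, hyb⟩ := lt_min_iff.1 hy
  obtain ⟨w, hw, hw'⟩ := exists_hasDerivAt_eq_slope h h' hxy
    (fun p hp => (hd p ⟨hp.1, hp.2.trans hyb.le⟩).continuousAt.continuousWithinAt)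
    (fun p hp => hd p ⟨hp.1.le, hp.2.le.trans hyb.le⟩)
  have h1 : 0 < slope h' x w := hsub ⟨hw.1, hw.2.trans hyz⟩
  rw [slope_def_field, h0, sub_zero] at h1
  have h3 : 0 < h' w := (div_pos_iff_of_pos_right (sub_pos.2 hw.1)).1 h1
  have h4 : h' w ≤ 0 := hw' ▸ div_nonpos_of_nonpos_of_nonneg
    (sub_nonpos.2 (hmax y ⟨hxy.le, hyb.le⟩)) (sub_nonneg.2 hxy.le)
  linarith

/-- Second derivative test at a critical point which is a maximum over `[0,1]`. -/
lemma second_deriv_nonpos_of_max {h h' : ℝ → ℝ} {x c : ℝ} (hx : x ∈ Icc (0:ℝ) 1)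
    (hd : ∀ y ∈ Icc (0:ℝ) 1, HasDerivAt h (h' y) y) (h0 : h' x = 0) (h2 : HasDerivAt h' c x)
    (hmax : ∀ y ∈ Icc (0:ℝ) 1, h y ≤ h x) : c ≤ 0 := by
  rcases hx.2.lt_or_eq with hx1 | rfl
  · exact second_deriv_nonpos_of_max_right hx1 (fun y hy => hd y ⟨hx.1.trans hy.1, hy.2⟩) h0 h2
      fun y hy => hmax y ⟨hx.1.trans hy.1, hy.2⟩
  · refine second_deriv_nonpos_of_max_right (h := fun y => h (-y)) (h' := fun y => -h' (-y))
      (x := -1) (b := 0) (by norm_num) (fun y hy => ?_) (by simpa using h0) ?_ fun y hy => ?_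
    · exact (hd (-y) ⟨by linarith [hy.2], by linarith [hy.1]⟩).comp_neg_id
    · have h2' : HasDerivAt h' c (-(-1)) := by rwa [neg_neg]
      have h3 := h2'.comp_neg_id.neg
      rwa [neg_neg] at h3
    · simpa using hmax (-y) ⟨by linarith [hy.2], by linarith [hy.1]⟩

/-- At a maximum over `[0,1]` of a function whose outward derivatives at the endpoints are
nonpositive, the derivative vanishes. -/
lemma deriv_eq_zero_of_max {h h' : ℝ → ℝ} {x : ℝ} (hx : x ∈ Icc (0:ℝ) 1)
    (hd : ∀ y ∈ Icc (0:ℝ) 1, HasDerivAt h (h' y) y) (h0 : 0 ≤ h' 0) (h1 : h' 1 ≤ 0)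
    (hmax : ∀ y ∈ Icc (0:ℝ) 1, h y ≤ h x) : h' x = 0 := by
  refine le_antisymm ?_ ?_
  · rcases hx.2.lt_or_eq with hx1 | rfl
    · exact (hd x hx).nonpos_of_forall_le_right hx1
        fun y hy => hmax y ⟨hx.1.trans hy.1.le, hy.2⟩
    · exact h1
  · rcases hx.1.lt_or_eq with hx0 | rfl
    · exact (hd x hx).nonneg_of_forall_le_left hx0
        fun y hy => hmax y ⟨hy.1, hy.2.le.trans hx.2⟩
    · exact h0

/-- Weak parabolic maximum principle on `[t₁, ∞) × [0,1]` with Neumann conditions, where the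
differential inequality is only required at positive spatially critical values. -/
lemma parabolic_max_principle {ν C t₁ : ℝ} (hν : 0 ≤ ν) {d dt dx dxx : ℝ → ℝ → ℝ}
    (hc : ContinuousOn (fun p : ℝ × ℝ => d p.1 p.2) (Ici t₁ ×ˢ Icc (0:ℝ) 1))
    (hdt : ∀ t > t₁, ∀ x ∈ Icc (0:ℝ) 1, HasDerivAt (fun s => d s x) (dt t x) t)
    (hdx : ∀ t > t₁, ∀ x ∈ Icc (0:ℝ) 1, HasDerivAt (fun y => d t y) (dx t x) x)
    (hdxx : ∀ t > t₁, ∀ x ∈ Icc (0:ℝ) 1, HasDerivAt (fun y => dx t y) (dxx t x) x)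
    (h0 : ∀ t > t₁, 0 ≤ dx t 0) (h1 : ∀ t > t₁, dx t 1 ≤ 0)
    (hineq : ∀ t > t₁, ∀ x ∈ Icc (0:ℝ) 1, 0 < d t x → dx t x = 0 →
      dt t x ≤ ν * dxx t x + C * d t x)
    (hinit : ∀ x ∈ Icc (0:ℝ) 1, d t₁ x ≤ 0) :
    ∀ t ≥ t₁, ∀ x ∈ Icc (0:ℝ) 1, d t x ≤ 0 := by
  intro T hT z hz
  by_contra! hpos
  have hcomp : IsCompact (Icc t₁ T ×ˢ Icc (0:ℝ) 1) := isCompact_Icc.prod isCompact_Icc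
  have hcont : ContinuousOn (fun p : ℝ × ℝ => Real.exp (-(C + 1) * p.1) * d p.1 p.2)
      (Icc t₁ T ×ˢ Icc (0:ℝ) 1) :=
    (by fun_prop : Continuous fun p : ℝ × ℝ => Real.exp (-(C + 1) * p.1)).continuousOn.mul
      (hc.mono (prod_mono Icc_subset_Ici_self le_rfl))
  obtain ⟨⟨t, x⟩, ⟨ht, hx⟩, hmax⟩ :=
    hcomp.exists_isMaxOn ⟨(T, z), ⟨⟨hT, le_rfl⟩, hz⟩⟩ hcont
  have hmax' : ∀ s ∈ Icc t₁ T, ∀ y ∈ Icc (0:ℝ) 1,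
      Real.exp (-(C + 1) * s) * d s y ≤ Real.exp (-(C + 1) * t) * d t x :=
    fun s hs y hy => hmax (show (s, y) ∈ Icc t₁ T ×ˢ Icc (0:ℝ) 1 from ⟨hs, hy⟩)
  simp only at ht hx
  have hdpos : 0 < d t x := by
    have h2 := hmax' T ⟨hT, le_rfl⟩ z hz
    have h3 : 0 < Real.exp (-(C + 1) * T) * d T z := by positivity
    exact pos_of_mul_pos_right (h3.trans_le h2) (Real.exp_pos _).le
  have htt : t₁ < t := by
    rcases ht.1.lt_or_eq with h | rfl
    · exact h
    · exact absurd (hinit x hx) hdpos.not_ge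
  have hxmax : ∀ y ∈ Icc (0:ℝ) 1, d t y ≤ d t x := fun y hy =>
    le_of_mul_le_mul_left (hmax' t ht y hy) (Real.exp_pos _)
  have hx0 : dx t x = 0 := deriv_eq_zero_of_max hx (hdx t htt) (h0 t htt) (h1 t htt) hxmax
  have hxx : dxx t x ≤ 0 := second_deriv_nonpos_of_max hx (hdx t htt) hx0 (hdxx t htt x hx) hxmax
  have htd : HasDerivAt (fun s => Real.exp (-(C + 1) * s) * d s x)
      (Real.exp (-(C + 1) * t) * (-(C + 1)) * d t x + Real.exp (-(C + 1) * t) * dt t x) t := by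
    have he : HasDerivAt (fun s => Real.exp (-(C + 1) * s))
        (Real.exp (-(C + 1) * t) * (-(C + 1))) t := by
      simpa using ((hasDerivAt_id t).const_mul (-(C + 1))).exp
    exact he.mul (hdt t htt x hx)
  have h4 := htd.nonneg_of_forall_le_left htt fun s hs =>
    hmax' s ⟨hs.1, hs.2.le.trans ht.2⟩ x hx
  have h5 : 0 ≤ dt t x - (C + 1) * d t x := by
    refine nonneg_of_mul_nonneg_right (a := Real.exp (-(C + 1) * t)) ?_ (Real.exp_pos _)
    linarith
  have h6 := hineq t htt x hx hdpos hx0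
  nlinarith [mul_nonpos_of_nonneg_of_nonpos hν hxx]

/-- Continuous functions on `[0,1]` are dominated by positive ones up to a small factor. -/
lemma exists_pos_forall_mul_le {g h : ℝ → ℝ} (hg : ContinuousOn g (Icc (0:ℝ) 1))
    (hh : ContinuousOn h (Icc (0:ℝ) 1)) (hpos : ∀ x ∈ Icc (0:ℝ) 1, 0 < h x) :
    ∃ ε₀ > 0, ∀ ε, 0 ≤ ε → ε ≤ ε₀ → ∀ x ∈ Icc (0:ℝ) 1, ε * g x ≤ h x := by
  obtain ⟨x₀, hx₀, hmin⟩ := isCompact_Icc.exists_isMinOn (nonempty_Icc.2 zero_le_one) hh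
  obtain ⟨C, hC⟩ := isCompact_Icc.exists_bound_of_continuousOn hg
  have hC0 : 0 ≤ C := (norm_nonneg _).trans (hC x₀ hx₀)
  refine ⟨h x₀ / (C + 1), div_pos (hpos x₀ hx₀) (by linarith), fun ε h0 hε x hx => ?_⟩
  have h1 : g x ≤ C + 1 := by linarith [le_abs_self (g x), hC x hx, Real.norm_eq_abs (g x)]
  calc ε * g x ≤ ε * (C + 1) := by gcongr
    _ ≤ h x₀ := (le_div_iff₀ (by linarith)).1 hε
    _ ≤ h x := hmin hx

/-- A nonnegative solution with nontrivial data is positive somewhere. -/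
lemma ParaSol.exists_pos {ν : ℝ} {a f u₀ : ℝ → ℝ} {u ut ux uxx : ℝ → ℝ → ℝ}
    (hu : ParaSol ν a f u₀ u ut ux uxx)
    (hne : (∃ x ∈ Icc (0:ℝ) 1, f x ≠ 0) ∨ (∃ x ∈ Icc (0:ℝ) 1, u₀ x ≠ 0)) :
    ∃ t ≥ 0, ∃ x ∈ Icc (0:ℝ) 1, 0 < u t x := by
  by_contra! hall
  have hz : ∀ t ≥ 0, ∀ x ∈ Icc (0:ℝ) 1, u t x = 0 := fun t ht x hx =>
    le_antisymm (hall t ht x hx) (hu.nonneg t ht x hx)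
  rcases hne with ⟨x, hx, hfx⟩ | ⟨x, hx, hux⟩
  · have h1 : (0:ℝ) < 1 := one_pos
    have hut : ut 1 x = 0 := by
      refine (hu.hdt 1 h1 x hx).unique ((hasDerivAt_const (1:ℝ) (0:ℝ)).congr_of_eventuallyEq ?_)
      filter_upwards [lt_mem_nhds h1] with s hs using hz s hs.le x hx
    have key : ∀ y ∈ Icc (0:ℝ) 1, ux 1 y = 0 := fun y hy =>
      deriv_eq_zero_of_max hy (hu.hdx 1 h1) (hu.neumann0 1 h1).ge (hu.neumann1 1 h1).le
        fun w hw => by rw [hz 1 h1.le w hw, hz 1 h1.le y hy]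
    have huxx : uxx 1 x = 0 :=
      (uniqueDiffOn_Icc h1 x hx).eq_deriv _ (hu.hdxx 1 h1 x hx).hasDerivWithinAt
        ((hasDerivWithinAt_const x _ (0:ℝ)).congr key (key x hx))
    have := hu.eqn 1 h1 x hx
    rw [hut, huxx, key x hx, hz 1 h1.le x hx] at this
    exact hfx (by linarith)
  · exact hux ((hu.init x hx).symm.trans (hz 0 le_rfl x hx))

/-- Comparison of a solution with the barrier `ū + c e^{-δ (t - t₂)} (ū - ε φ)`, from above
(`σ = 1`) or from below (`σ = -1`). -/
lemma ParaSol.barrier {ν : ℝ} (hν : 0 ≤ ν) {a f u₀ : ℝ → ℝ} {u ut ux uxx : ℝ → ℝ → ℝ}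
    (hu : ParaSol ν a f u₀ u ut ux uxx) {A lam : ℝ} (hA : ∀ x ∈ Icc (0:ℝ) 1, |a x| ≤ A)
    {φ φ' φ'' : ℝ → ℝ} (hφ : C2On01 φ φ' φ'') (hφ'0 : φ' 0 = 0) (hφ'1 : φ' 1 = 0)
    (hφ_eq : ∀ x ∈ Icc (0:ℝ) 1, -ν * φ'' x - a x * φ x = -lam * φ x)
    {ubar ubar' ubar'' : ℝ → ℝ} (hubar : C2On01 ubar ubar' ubar'')
    (hubar'0 : ubar' 0 = 0) (hubar'1 : ubar' 1 = 0)
    (hubar_eq : ∀ x ∈ Icc (0:ℝ) 1,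
      -ν * ubar'' x + (1/2) * (ubar' x)^2 = a x * ubar x + f x)
    {σ c ε δ t₂ : ℝ} (hσ : σ ≠ 0) (ht₂ : 0 ≤ t₂) (hσc : 0 ≤ σ * c)
    (hσc' : ∀ e, 0 < e → e ≤ 1 → 0 ≤ 1 + c * e) (hδ : 0 ≤ δ)
    (hε : ∀ x ∈ Icc (0:ℝ) 1,
      (1/2) * ε^2 * (φ' x)^2 + δ * (ubar x - ε * φ x) ≤ ε * lam * φ x + f x)
    (hinit : ∀ x ∈ Icc (0:ℝ) 1,
      σ * (u t₂ x - ubar x) ≤ σ * c * (ubar x - ε * φ x)) :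
    ∀ t ≥ t₂, ∀ x ∈ Icc (0:ℝ) 1,
      σ * (u t x - ubar x) ≤ σ * c * Real.exp (-δ * (t - t₂)) * (ubar x - ε * φ x) := by
  have hφc : ContinuousOn φ (Icc 0 1) := fun x hx => (hφ.1 x hx).continuousAt.continuousWithinAt
  have hbc : ContinuousOn ubar (Icc 0 1) :=
    fun x hx => (hubar.1 x hx).continuousAt.continuousWithinAt
  have hmaps : MapsTo (Prod.snd : ℝ × ℝ → ℝ) (Ici t₂ ×ˢ Icc (0:ℝ) 1) (Icc 0 1) :=
    fun p hp => hp.2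
  have hφc2 := hφc.comp continuousOn_snd hmaps
  have hbc2 := hbc.comp continuousOn_snd hmaps
  have main := parabolic_max_principle (ν := ν) (C := A) (t₁ := t₂) hν
    (d := fun t x => σ * (u t x - (ubar x + c * Real.exp (-δ * (t - t₂)) * (ubar x - ε * φ x))))
    (dt := fun t x => σ * (ut t x
      - c * (Real.exp (-δ * (t - t₂)) * -δ) * (ubar x - ε * φ x)))
    (dx := fun t x => σ * (ux t x
      - (ubar' x + c * Real.exp (-δ * (t - t₂)) * (ubar' x - ε * φ' x))))
    (dxx := fun t x => σ * (uxx t x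
      - (ubar'' x + c * Real.exp (-δ * (t - t₂)) * (ubar'' x - ε * φ'' x))))
    ?_ ?_ ?_ ?_ ?_ ?_ ?_ ?_
  · intro t ht x hx
    have := main t ht x hx
    linarith
  · refine continuousOn_const.mul
      ((hu.cont.mono (prod_mono (Ici_subset_Ici.2 ht₂) le_rfl)).sub (hbc2.add ?_))
    exact ((by fun_prop : Continuous fun p : ℝ × ℝ =>
      c * Real.exp (-δ * (p.1 - t₂))).continuousOn).mul (hbc2.sub (continuousOn_const.mul hφc2))
  · intro t ht x hx
    have he : HasDerivAt (fun s => Real.exp (-δ * (s - t₂)))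
        (Real.exp (-δ * (t - t₂)) * -δ) t := by
      simpa using (((hasDerivAt_id t).sub_const t₂).const_mul (-δ)).exp
    exact ((hu.hdt t (ht₂.trans_lt ht) x hx).sub
      (((he.const_mul c).mul_const (ubar x - ε * φ x)).const_add (ubar x))).const_mul σ
  · intro t ht x hx
    exact ((hu.hdx t (ht₂.trans_lt ht) x hx).sub ((hubar.1 x hx).add
      (((hubar.1 x hx).sub ((hφ.1 x hx).const_mul ε)).const_mul _))).const_mul σ
  · intro t ht x hx
    exact ((hu.hdxx t (ht₂.trans_lt ht) x hx).sub ((hubar.2.1 x hx).add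
      (((hubar.2.1 x hx).sub ((hφ.2.1 x hx).const_mul ε)).const_mul _))).const_mul σ
  · intro t ht
    simp [hu.neumann0 t (ht₂.trans_lt ht), hubar'0, hφ'0]
  · intro t ht
    simp [hu.neumann1 t (ht₂.trans_lt ht), hubar'1, hφ'1]
  · intro t ht x hx hpos hcrit
    have he0 : 0 < Real.exp (-δ * (t - t₂)) := Real.exp_pos _
    have he1 : Real.exp (-δ * (t - t₂)) ≤ 1 :=
      Real.exp_le_one_iff.2 (by nlinarith [sub_pos.2 (show t₂ < t from ht)])
    have hc1 := hσc' _ he0 he1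
    set e := Real.exp (-δ * (t - t₂)) with hedef
    have hux : ux t x = ubar' x + c * e * (ubar' x - ε * φ' x) := by
      have := (mul_eq_zero.1 hcrit).resolve_left hσ
      linarith
    have heq := hu.eqn t (ht₂.trans_lt ht) x hx
    rw [hux] at heq
    have hb := hubar_eq x hx
    have hp := hφ_eq x hx
    have hk : 0 ≤ σ * c * e := mul_nonneg hσc he0.le
    have h1 := mul_nonneg hk (sub_nonneg.2 (hε x hx))
    have h2 := mul_nonneg (mul_nonneg hk hc1) (sq_nonneg (ubar' x - ε * φ' x))
    have h3 := mul_nonneg (sub_nonneg.2 ((le_abs_self _).trans (hA x hx))) hpos.le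
    linear_combination σ * heq + h1 + (1/2) * h2 + h3 + (-σ * (1 + c * e)) * hb
      + σ * c * e * ε * hp
  · intro x hx
    have := hinit x hx
    simp only [sub_self, mul_zero, Real.exp_zero, mul_one]
    linarith

/-- Strong positivity: a nonnegative solution which is positive at one point is positive everywhere
one unit of time later. -/
lemma ParaSol.pos_add_one {ν : ℝ} (hν : 0 < ν) {a f u₀ : ℝ → ℝ} {u ut ux uxx : ℝ → ℝ → ℝ}
    (hu : ParaSol ν a f u₀ u ut ux uxx) {A : ℝ} (hA : ∀ x ∈ Icc (0:ℝ) 1, |a x| ≤ A)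
    (hf : ∀ x ∈ Icc (0:ℝ) 1, 0 ≤ f x) {t₁ x₁ : ℝ} (ht₁ : 0 ≤ t₁) (hx₁ : x₁ ∈ Icc (0:ℝ) 1)
    (hpos : 0 < u t₁ x₁) : ∀ x ∈ Icc (0:ℝ) 1, 0 < u (t₁ + 1) x := by
  have hA0 : 0 ≤ A := (abs_nonneg _).trans (hA x₁ hx₁)
  obtain ⟨r, hr, hur⟩ : ∃ r > 0, ∀ x ∈ Icc (0:ℝ) 1, |x - x₁| < r → u t₁ x₁ / 2 ≤ u t₁ x := by
    have hc : ContinuousOn (fun x => u t₁ x) (Icc (0:ℝ) 1) :=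
      hu.cont.comp (f := fun x => (t₁, x)) (by fun_prop) fun x hx => ⟨ht₁, hx⟩
    obtain ⟨r, hr, h⟩ := Metric.continuousWithinAt_iff.1 (hc x₁ hx₁) (u t₁ x₁ / 2) (by linarith)
    refine ⟨r, hr, fun x hx hxr => ?_⟩
    have := h hx hxr
    rw [Real.dist_eq, abs_lt] at this
    linarith [this.1]
  obtain ⟨τ, hτ, hτ1, hb⟩ : ∃ τ > 0, τ ≤ 1 ∧
      Real.exp (-r^2 / (4 * ν * τ)) / τ < Real.exp (-1 / (4 * ν)) / 2 := by
    have hlim : Tendsto (fun y : ℝ => y * Real.exp (-(r^2 / (4 * ν)) * y)) atTop (𝓝 0) := by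
      have := Real.tendsto_pow_mul_exp_neg_atTop_nhds_zero 1
      have h2 := (this.comp (tendsto_id.const_mul_atTop
        (show 0 < r^2 / (4 * ν) by positivity))).const_mul (r^2 / (4 * ν))⁻¹
      rw [mul_zero] at h2
      refine h2.congr fun y => ?_
      simp only [Function.comp, id, pow_one, neg_mul]
      field_simp
    obtain ⟨y, hy, hy1⟩ := ((hlim.eventually (gt_mem_nhds
      (show 0 < Real.exp (-1 / (4 * ν)) / 2 by positivity))).and (eventually_ge_atTop 1)).exists
    have hy0 : 0 < y := by linarith
    refine ⟨y⁻¹, inv_pos.2 hy0, inv_le_one_of_one_le₀ hy1, ?_⟩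
    have hexp : -r^2 / (4 * ν * y⁻¹) = -(r^2 / (4 * ν)) * y := by field_simp
    rwa [hexp, div_inv_eq_mul, mul_comm]
  set b := Real.exp (-r^2 / (4 * ν * τ)) / τ with hbdef
  have hb0 : 0 < b := by positivity
  obtain ⟨κ, hκ, hκ1, hκ2⟩ : ∃ κ > 0, κ ≤ 4 * ν^2 * τ^2 ∧ κ ≤ τ * (u t₁ x₁ / 2) :=
    ⟨min (4 * ν^2 * τ^2) (τ * (u t₁ x₁ / 2)), lt_min (by positivity) (by positivity),
      min_le_left _ _, min_le_right _ _⟩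
  have main := parabolic_max_principle (ν := ν) (C := A) (t₁ := t₁) hν.le
    (d := fun t x => κ * Real.exp (-A * (t - t₁)) *
      (Real.exp (-(x - x₁)^2 / (4 * ν * (t - t₁ + τ))) / (t - t₁ + τ) - b) - u t x)
    (dt := fun t x => κ * (Real.exp (-A * (t - t₁)) * -A) *
      (Real.exp (-(x - x₁)^2 / (4 * ν * (t - t₁ + τ))) / (t - t₁ + τ) - b)
      + κ * Real.exp (-A * (t - t₁)) *
      (Real.exp (-(x - x₁)^2 / (4 * ν * (t - t₁ + τ))) *
        ((x - x₁)^2 / (4 * ν * (t - t₁ + τ)^3) - 1 / (t - t₁ + τ)^2)) - ut t x)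
    (dx := fun t x => κ * Real.exp (-A * (t - t₁)) *
      (Real.exp (-(x - x₁)^2 / (4 * ν * (t - t₁ + τ))) *
        (-(x - x₁) / (2 * ν * (t - t₁ + τ)^2))) - ux t x)
    (dxx := fun t x => κ * Real.exp (-A * (t - t₁)) *
      (Real.exp (-(x - x₁)^2 / (4 * ν * (t - t₁ + τ))) *
        ((x - x₁)^2 / (4 * ν^2 * (t - t₁ + τ)^3) - 1 / (2 * ν * (t - t₁ + τ)^2))) - uxx t x)
    ?_ ?_ ?_ ?_ ?_ ?_ ?_ ?_
  · intro x hx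
    have h := main (t₁ + 1) (by linarith) x hx
    simp only [add_sub_cancel_left] at h
    have hE : Real.exp (-1 / (4 * ν)) / 2 ≤
        Real.exp (-(x - x₁)^2 / (4 * ν * (1 + τ))) / (1 + τ) := by
      have hd : (x - x₁)^2 ≤ 1 := by
        rw [sq_le_one_iff_abs_le_one, abs_le]
        constructor <;> linarith [hx.1, hx.2, hx₁.1, hx₁.2]
      have : -1 / (4 * ν) ≤ -(x - x₁)^2 / (4 * ν * (1 + τ)) := by
        rw [div_le_div_iff₀ (by positivity) (by positivity)]
        nlinarith [mul_pos hν hτ]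
      gcongr
      linarith
    have : 0 < κ * Real.exp (-A * 1) *
        (Real.exp (-(x - x₁)^2 / (4 * ν * (1 + τ))) / (1 + τ) - b) :=
      mul_pos (by positivity) (by linarith)
    linarith
  · refine ContinuousOn.sub ?_ (hu.cont.mono (prod_mono (Ici_subset_Ici.2 ht₁) le_rfl))
    have hs : ∀ p ∈ Ici t₁ ×ˢ Icc (0:ℝ) 1, p.1 - t₁ + τ ≠ 0 := fun p hp => by
      have : t₁ ≤ p.1 := hp.1
      linarith
    have hs' : ∀ p ∈ Ici t₁ ×ˢ Icc (0:ℝ) 1, 4 * ν * (p.1 - t₁ + τ) ≠ 0 := fun p hp =>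
      mul_ne_zero (by positivity) (hs p hp)
    fun_prop (disch := assumption)
  · intro t ht x hx
    have hs : 0 < t - t₁ + τ := by linarith [show t₁ < t from ht]
    have hid : HasDerivAt (fun s : ℝ => s - t₁) 1 t := (hasDerivAt_id t).sub_const t₁
    have he : HasDerivAt (fun s => Real.exp (-A * (s - t₁)))
        (Real.exp (-A * (t - t₁)) * -A) t := by
      simpa using (hid.const_mul (-A)).exp
    have hE : HasDerivAt (fun s => Real.exp (-(x - x₁)^2 / (4 * ν * (s - t₁ + τ))) / (s - t₁ + τ))
        (Real.exp (-(x - x₁)^2 / (4 * ν * (t - t₁ + τ))) *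
          ((x - x₁)^2 / (4 * ν * (t - t₁ + τ)^3) - 1 / (t - t₁ + τ)^2)) t := by
      have h1 := ((hasDerivAt_const t (-(x - x₁)^2)).div
        ((hid.add_const τ).const_mul (4 * ν)) (by positivity)).exp.div (hid.add_const τ) hs.ne'
      refine h1.congr_deriv ?_
      simp only [Pi.div_apply]
      field_simp
      ring
    exact ((he.const_mul κ).mul (hE.sub_const b)).sub (hu.hdt t (ht₁.trans_lt ht) x hx)
  · intro t ht x hx
    have hs : 0 < t - t₁ + τ := by linarith [show t₁ < t from ht]
    have hE : HasDerivAt (fun y => Real.exp (-(y - x₁)^2 / (4 * ν * (t - t₁ + τ))) / (t - t₁ + τ))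
        (Real.exp (-(x - x₁)^2 / (4 * ν * (t - t₁ + τ))) *
          (-(x - x₁) / (2 * ν * (t - t₁ + τ)^2))) x := by
      have h1 := ((((hasDerivAt_id x).sub_const x₁).pow 2).neg.div_const
        (4 * ν * (t - t₁ + τ))).exp.div_const (t - t₁ + τ)
      refine h1.congr_deriv ?_
      simp
      field_simp
      ring
    exact ((hE.sub_const b).const_mul _).sub (hu.hdx t (ht₁.trans_lt ht) x hx)
  · intro t ht x hx
    have hs : 0 < t - t₁ + τ := by linarith [show t₁ < t from ht]
    have hE : HasDerivAt (fun y => Real.exp (-(y - x₁)^2 / (4 * ν * (t - t₁ + τ))) *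
          (-(y - x₁) / (2 * ν * (t - t₁ + τ)^2)))
        (Real.exp (-(x - x₁)^2 / (4 * ν * (t - t₁ + τ))) *
        ((x - x₁)^2 / (4 * ν^2 * (t - t₁ + τ)^3) - 1 / (2 * ν * (t - t₁ + τ)^2))) x := by
      have hid := (hasDerivAt_id x).sub_const x₁
      have h1 := ((hid.pow 2).neg.div_const (4 * ν * (t - t₁ + τ))).exp.mul
        (hid.neg.div_const (2 * ν * (t - t₁ + τ)^2))
      refine h1.congr_deriv ?_
      simp
      field_simp
      ring
    exact (hE.const_mul _).sub (hu.hdxx t (ht₁.trans_lt ht) x hx)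
  · intro t ht
    have hs : 0 < t - t₁ + τ := by linarith [show t₁ < t from ht]
    have : 0 ≤ -(0 - x₁) := by linarith [hx₁.1]
    simp only [hu.neumann0 t (ht₁.trans_lt ht), sub_zero]
    positivity
  · intro t ht
    have hs : 0 < t - t₁ + τ := by linarith [show t₁ < t from ht]
    simp only [hu.neumann1 t (ht₁.trans_lt ht), sub_zero]
    refine mul_nonpos_of_nonneg_of_nonpos (by positivity)
      (mul_nonpos_of_nonneg_of_nonpos (by positivity)
        (div_nonpos_of_nonpos_of_nonneg (by linarith [hx₁.2]) (by positivity)))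
  · intro t ht x hx hpos hcrit
    have hs : τ ≤ t - t₁ + τ := by linarith [show t₁ < t from ht]
    have he0 : 0 < Real.exp (-A * (t - t₁)) := Real.exp_pos _
    have he1 : Real.exp (-A * (t - t₁)) ≤ 1 :=
      Real.exp_le_one_iff.2 (by nlinarith [sub_pos.2 (show t₁ < t from ht)])
    have heq := hu.eqn t (ht₁.trans_lt ht) x hx
    have hu0 := hu.nonneg t (ht₁.trans ht.le) x hx
    have hd : (x - x₁)^2 ≤ 1 := by
      rw [sq_le_one_iff_abs_le_one, abs_le]
      constructor <;> linarith [hx.1, hx.2, hx₁.1, hx₁.2]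
    set s := t - t₁ + τ with hsdef
    have hs0 : 0 < s := hτ.trans_le hs
    have hE1 : Real.exp (-(x - x₁)^2 / (4 * ν * s)) ≤ 1 :=
      Real.exp_le_one_iff.2 (div_nonpos_of_nonpos_of_nonneg (by nlinarith [sq_nonneg (x - x₁)])
        (by positivity))
    have hE0 : 0 < Real.exp (-(x - x₁)^2 / (4 * ν * s)) := Real.exp_pos _
    set E := Real.exp (-(x - x₁)^2 / (4 * ν * s)) with hEdef
    set e := Real.exp (-A * (t - t₁)) with hedef
    set ψ := κ * e * (E / s - b) with hψ
    have hux : ux t x = κ * e * (E * (-(x - x₁) / (2 * ν * s^2))) := by linarith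
    have hgrad : (1/2) * (ux t x)^2 ≤ κ * e * (E * (1 / (2 * s^2))) := by
      have h1 : κ * e * E * (x - x₁)^2 ≤ 4 * ν^2 * s^2 := by
        calc κ * e * E * (x - x₁)^2 ≤ κ * 1 * 1 * 1 := by gcongr
          _ ≤ 4 * ν^2 * τ^2 := by linarith
          _ ≤ 4 * ν^2 * s^2 := by gcongr
      have h2 : (1/2) * (ux t x)^2 = κ * e * E / (8 * ν^2 * s^4) * (κ * e * E * (x - x₁)^2) := by
        rw [hux]
        field_simp
        ring
      rw [h2]
      calc κ * e * E / (8 * ν^2 * s^4) * (κ * e * E * (x - x₁)^2)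
          ≤ κ * e * E / (8 * ν^2 * s^4) * (4 * ν^2 * s^2) := by gcongr
        _ = κ * e * (E * (1 / (2 * s^2))) := by
          field_simp
          ring
    have hheat : κ * e * (E * ((x - x₁)^2 / (4 * ν * s^3) - 1 / s^2))
        = ν * (κ * e * (E * ((x - x₁)^2 / (4 * ν^2 * s^3) - 1 / (2 * ν * s^2))))
          - κ * e * (E * (1 / (2 * s^2))) := by
      field_simp
      ring
    have hψ0 : 0 ≤ ψ := by linarith
    have habs := abs_le.1 (hA x hx)
    have h3 := mul_nonneg (sub_nonneg.2 habs.2) hpos.le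
    have h4 := mul_nonneg (neg_le_iff_add_nonneg.1 habs.1) hψ0
    have hAψ : κ * (e * -A) * (E / s - b) = -A * ψ := by rw [hψ]; ring
    rw [hAψ, hheat]
    linear_combination (-1) * heq + h3 + h4 + hgrad + hf x hx
  · intro x hx
    simp only [sub_self, mul_zero, Real.exp_zero, mul_one, zero_add]
    rw [sub_nonpos]
    rcases lt_or_ge |x - x₁| r with hxr | hxr
    · have hE1 : Real.exp (-(x - x₁)^2 / (4 * ν * τ)) ≤ 1 :=
        Real.exp_le_one_iff.2 (div_nonpos_of_nonpos_of_nonneg (by nlinarith [sq_nonneg (x - x₁)])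
          (by positivity))
      calc κ * (Real.exp (-(x - x₁)^2 / (4 * ν * τ)) / τ - b) ≤ κ * (1 / τ) := by
            refine mul_le_mul_of_nonneg_left ?_ hκ.le
            have : Real.exp (-(x - x₁)^2 / (4 * ν * τ)) / τ ≤ 1 / τ := by gcongr
            linarith
        _ ≤ u t₁ x₁ / 2 := by
            rw [mul_one_div, div_le_iff₀ hτ]
            linarith
        _ ≤ u t₁ x := hur x hx hxr
    · refine le_trans ?_ (hu.nonneg t₁ ht₁ x hx)
      refine mul_nonpos_of_nonneg_of_nonpos hκ.le (sub_nonpos.2 ?_)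
      rw [hbdef]
      have : r^2 ≤ (x - x₁)^2 := by
        rw [← sq_abs (x - x₁)]
        gcongr
      gcongr

/-- Long-time convergence assertion of Theorem 3.11: under the spectral assumption
`λ₁(-ν d²/dx² - a) < 0` and `min a < 0`, the solution of the evolution problem converges
uniformly on `[0,1]`, as `T → ∞`, to the unique positive Neumann stationary solution `ū` of
`-ν ū'' + (1/2)(ū')² = a ū + f`. -/
theorem stmt_18 (ν : ℝ) (hν : 0 < ν) (a f u₀ : ℝ → ℝ)
    (ha_smooth : ContDiffOn ℝ (⊤ : ℕ∞) a (Icc (0:ℝ) 1))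
    (hf_smooth : ContDiffOn ℝ (⊤ : ℕ∞) f (Icc (0:ℝ) 1))
    (hu₀_smooth : ContDiffOn ℝ (⊤ : ℕ∞) u₀ (Icc (0:ℝ) 1))
    (hf_nonneg : ∀ x ∈ Icc (0:ℝ) 1, 0 ≤ f x)
    (hu₀_nonneg : ∀ x ∈ Icc (0:ℝ) 1, 0 ≤ u₀ x)
    (hne : (∃ x ∈ Icc (0:ℝ) 1, f x ≠ 0) ∨ (∃ x ∈ Icc (0:ℝ) 1, u₀ x ≠ 0))
    (lam : ℝ) (hlam : 0 < lam) (φ φ' φ'' : ℝ → ℝ)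
    (hφ : C2On01 φ φ' φ'')
    (hφ_pos : ∀ x ∈ Icc (0:ℝ) 1, 0 < φ x)
    (hφ'0 : φ' 0 = 0) (hφ'1 : φ' 1 = 0)
    (hφ_eq : ∀ x ∈ Icc (0:ℝ) 1, -ν * φ'' x - a x * φ x = -lam * φ x)
    (ha_neg : ∃ x₀ ∈ Icc (0:ℝ) 1, a x₀ < 0)
    (ubar ubar' ubar'' : ℝ → ℝ)
    (hubar : C2On01 ubar ubar' ubar'')
    (hubar_pos : ∀ x ∈ Icc (0:ℝ) 1, 0 < ubar x)
    (hubar'0 : ubar' 0 = 0) (hubar'1 : ubar' 1 = 0)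
    (hubar_eq : ∀ x ∈ Icc (0:ℝ) 1,
      -ν * ubar'' x + (1/2) * (ubar' x)^2 = a x * ubar x + f x)
    (u ut ux uxx : ℝ → ℝ → ℝ)
    (hu : ParaSol ν a f u₀ u ut ux uxx) :
    Tendsto (fun T : ℝ => sSup ((fun x => |u T x - ubar x|) '' Icc (0:ℝ) 1))
      atTop (𝓝 0) := by
  have hIcc : (Icc (0:ℝ) 1).Nonempty := nonempty_Icc.2 zero_le_one
  obtain ⟨A, hA⟩ := isCompact_Icc.exists_bound_of_continuousOn ha_smooth.continuousOn
  simp only [Real.norm_eq_abs] at hA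
  have hφc : ContinuousOn φ (Icc 0 1) := fun x hx => (hφ.1 x hx).continuousAt.continuousWithinAt
  have hφ'c : ContinuousOn φ' (Icc 0 1) :=
    fun x hx => (hφ.2.1 x hx).continuousAt.continuousWithinAt
  have hbc : ContinuousOn ubar (Icc 0 1) :=
    fun x hx => (hubar.1 x hx).continuousAt.continuousWithinAt
  obtain ⟨t₁, ht₁, x₁, hx₁, hpos₁⟩ := hu.exists_pos hne
  have hpos := hu.pos_add_one hν hA hf_nonneg ht₁ hx₁ hpos₁
  set t₂ := t₁ + 1 with ht₂def
  have ht₂ : 0 ≤ t₂ := by linarith [show 0 ≤ t₁ from ht₁]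
  have huc : ContinuousOn (fun x => u t₂ x) (Icc (0:ℝ) 1) :=
    hu.cont.comp (f := fun x => (t₂, x)) (by fun_prop) fun x hx => ⟨ht₂, hx⟩
  obtain ⟨ε₁, hε₁, h₁⟩ := exists_pos_forall_mul_le hφc huc hpos
  obtain ⟨ε₂, hε₂, h₂⟩ := exists_pos_forall_mul_le (hφc.const_mul 2) hbc hubar_pos
  obtain ⟨ε₃, hε₃, h₃⟩ := exists_pos_forall_mul_le (hφ'c.pow 2) (hφc.const_mul lam)
    fun x hx => mul_pos hlam (hφ_pos x hx)
  obtain ⟨ε, hε, hle₁, hle₂, hle₃⟩ : ∃ ε > 0, ε ≤ ε₁ ∧ ε ≤ ε₂ ∧ ε ≤ ε₃ :=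
    ⟨min ε₁ (min ε₂ ε₃), by positivity, min_le_left _ _,
      (min_le_right _ _).trans (min_le_left _ _), (min_le_right _ _).trans (min_le_right _ _)⟩
  have hgc : ContinuousOn (fun x => ubar x - ε * φ x) (Icc (0:ℝ) 1) :=
    hbc.sub (hφc.const_mul ε)
  have hg : ∀ x ∈ Icc (0:ℝ) 1, 0 < ubar x - ε * φ x := fun x hx => by
    have := h₂ ε hε.le hle₂ x hx
    have := mul_pos hε (hφ_pos x hx)
    linarith
  obtain ⟨δ, hδ, hδ'⟩ := exists_pos_forall_mul_le hgc (hφc.const_mul (ε * lam / 2))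
    fun x hx => mul_pos (by positivity) (hφ_pos x hx)
  have hbar : ∀ x ∈ Icc (0:ℝ) 1,
      (1/2) * ε^2 * (φ' x)^2 + δ * (ubar x - ε * φ x) ≤ ε * lam * φ x + f x := fun x hx => by
    have e1 := mul_le_mul_of_nonneg_left (h₃ ε hε.le hle₃ x hx) hε.le
    rw [Pi.pow_apply] at e1
    have e2 := hδ' δ hδ.le le_rfl x hx
    have e3 := hf_nonneg x hx
    linarith
  obtain ⟨M', hM', hMle⟩ := exists_pos_forall_mul_le (huc.sub hbc) hgc hg
  obtain ⟨G, hG⟩ := isCompact_Icc.exists_bound_of_continuousOn hgc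
  have hG' : ∀ x ∈ Icc (0:ℝ) 1, ubar x - ε * φ x ≤ G := fun x hx =>
    (le_abs_self _).trans (hG x hx)
  have hup := hu.barrier hν.le hA hφ hφ'0 hφ'1 hφ_eq hubar hubar'0 hubar'1 hubar_eq
    (σ := 1) (c := M'⁻¹) one_ne_zero ht₂ (by positivity) (fun e he _ => by positivity) hδ.le hbar
    fun x hx => by
      rw [one_mul, one_mul, ← div_eq_inv_mul, le_div_iff₀' hM']
      exact hMle M' hM'.le le_rfl x hx
  have hlow := hu.barrier hν.le hA hφ hφ'0 hφ'1 hφ_eq hubar hubar'0 hubar'1 hubar_eq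
    (σ := -1) (c := -1) (by norm_num) ht₂ (by norm_num) (fun e _ he => by linarith) hδ.le hbar
    fun x hx => by
      have := h₁ ε hε.le hle₁ x hx
      linarith
  have hlim : Tendsto (fun T : ℝ => (M'⁻¹ + 1) * G * Real.exp (-δ * (T - t₂))) atTop (𝓝 0) := by
    have h1 : Tendsto (fun T : ℝ => -δ * (T - t₂)) atTop atBot :=
      (tendsto_atTop_add_const_right atTop (-t₂) tendsto_id).const_mul_atTop_of_neg
        (neg_neg_of_pos hδ)
    simpa using (Real.tendsto_exp_atBot.comp h1).const_mul ((M'⁻¹ + 1) * G)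
  refine squeeze_zero' (Eventually.of_forall fun T => ?_) ?_ hlim
  · refine Real.sSup_nonneg ?_
    rintro _ ⟨x, -, rfl⟩
    exact abs_nonneg _
  · filter_upwards [eventually_ge_atTop t₂] with T hT
    refine csSup_le (hIcc.image _) ?_
    rintro _ ⟨x, hx, rfl⟩
    have hu1 := hup T hT x hx
    have hl1 := hlow T hT x hx
    have he := Real.exp_pos (-δ * (T - t₂))
    have hk : Real.exp (-δ * (T - t₂)) * (ubar x - ε * φ x) ≤ Real.exp (-δ * (T - t₂)) * G :=
      mul_le_mul_of_nonneg_left (hG' x hx) he.le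
    have hk0 : 0 ≤ Real.exp (-δ * (T - t₂)) * (ubar x - ε * φ x) :=
      mul_nonneg he.le (hg x hx).le
    have hkM := mul_le_mul_of_nonneg_left hk (inv_pos.2 hM').le
    have hkM0 := mul_nonneg (inv_pos.2 hM').le hk0
    rw [abs_le]
    constructor <;> linarith
end
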